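/- Let C_t be the primitive Reed–Solomon [n_t, n_t/3] code over F_{2^{2t}} with n_t = 2^{2t} − 1, defined by check polynomial (x−1)(x−ω)⋯(x−ω^{n_t/3 − 1}) for ω primitive. Fix m ≥ 3. Then there exist constants α_r, α_a > 0, independent of t, such that for all t: (1) ρ(C_t,…,C_t) (m copies) ≤ 1/n_t; (2) ρ_r(T_m^1, C_t^{⊗m}) ≥ α_r; (3) ρ_a(C_t^{⊗m}) ≥ α_a. In particular, product expansion of a family of codes is strictly stronger than robust and agreement testability of their tensor products. -/

import Mathlib

noncomputable section

open Polynomial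

/-- Normalized Hamming weight. -/
def normWt {ι F : Type*} [Fintype ι] [Zero F] (x : ι → F) : ℝ :=
  (Nat.card {p : ι // x p ≠ 0} : ℝ) / (Fintype.card ι : ℝ)

/-- Normalized Hamming distance from a word to a set of words. -/
def distTo {ι F : Type*} [Fintype ι] [AddGroup F] (x : ι → F) (S : Set (ι → F)) : ℝ :=
  sInf ((fun c => normWt (x - c)) '' S)

/-- Normalized minimum distance of a code. -/
def minDist {ι F : Type*} [Fintype ι] [Zero F] (S : Set (ι → F)) : ℝ :=
  sInf (normWt '' (S \ {0}))

/-- Restriction of a word on a grid to the axis-`i` line through `y`. -/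
def lineRestrict {F : Type*} {m : ℕ} {n : Fin m → ℕ}
    (x : (∀ j, Fin (n j)) → F) (i : Fin m) (y : ∀ j, Fin (n j)) : Fin (n i) → F :=
  fun s => x (Function.update y i s)

/-- `‖x‖_i`: the fraction of axis-`i` parallel lines on which `x` is nonzero. -/
def lineWt {F : Type*} [Zero F] {m : ℕ} {n : Fin m → ℕ}
    (x : (∀ j, Fin (n j)) → F) (i : Fin m) : ℝ :=
  (Nat.card {y : ∀ j, Fin (n j) // lineRestrict x i y ≠ 0} : ℝ) /
    (Fintype.card (∀ j, Fin (n j)) : ℝ)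

/-- `C^{(i)}`: words all of whose axis-`i` lines belong to `C i`. -/
def axisCode {F : Type*} {m : ℕ} {n : Fin m → ℕ}
    (C : ∀ i, Set (Fin (n i) → F)) (i : Fin m) : Set ((∀ j, Fin (n j)) → F) :=
  {x | ∀ y, lineRestrict x i y ∈ C i}

/-- Tensor product code `C₁ ⊗ ⋯ ⊗ C_m`. -/
def prodCode {F : Type*} {m : ℕ} {n : Fin m → ℕ}
    (C : ∀ i, Set (Fin (n i) → F)) : Set ((∀ j, Fin (n j)) → F) :=
  ⋂ i, axisCode C i

/-- Dual code w.r.t. the standard bilinear form. -/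
def dualCode {ι F : Type*} [Fintype ι] [CommRing F] (S : Set (ι → F)) : Set (ι → F) :=
  {x | ∀ c ∈ S, ∑ p, x p * c p = 0}

/-- `C₁ ⊞ ⋯ ⊞ C_m := (C₁^⊥ ⊗ ⋯ ⊗ C_m^⊥)^⊥`. -/
def boxCode {F : Type*} [CommRing F] {m : ℕ} {n : Fin m → ℕ}
    (C : ∀ i, Set (Fin (n i) → F)) : Set ((∀ j, Fin (n j)) → F) :=
  dualCode (prodCode (fun i => dualCode (C i)))

/-- `ρ`-product-expansion of a collection of codes. -/
def productExpanding {F : Type*} [Field F] {m : ℕ} {n : Fin m → ℕ}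
    (C : ∀ i, Set (Fin (n i) → F)) (ρ : ℝ) : Prop :=
  ∀ c ∈ boxCode C, ∃ a : Fin m → ((∀ j, Fin (n j)) → F),
    (∀ i, a i ∈ axisCode C i) ∧ c = ∑ i, a i ∧
      ρ * ∑ i, lineWt (a i) i ≤ normWt c

/-- The product-expansion constant `ρ(𝒞)`. -/
def prodExpConst {F : Type*} [Field F] {m : ℕ} {n : Fin m → ℕ}
    (C : ∀ i, Set (Fin (n i) → F)) : ℝ :=
  sSup {ρ : ℝ | productExpanding C ρ}

/-- Expected distance under the axis-parallel line test `T_m^1`. -/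
def lineTestE {F : Type*} [Field F] {m : ℕ} {n : Fin m → ℕ}
    (C : ∀ i, Set (Fin (n i) → F)) (x : (∀ j, Fin (n j)) → F) : ℝ :=
  (∑ i, (∑ y : ∀ j, Fin (n j), distTo (lineRestrict x i y) (C i)) /
      (Fintype.card (∀ j, Fin (n j)) : ℝ)) / (m : ℝ)

/-- Robustness constant `ρ_r(T_m^1, ⊗𝒞)` of the axis-parallel line test. -/
def lineRobustConst {F : Type*} [Field F] {m : ℕ} {n : Fin m → ℕ}
    (C : ∀ i, Set (Fin (n i) → F)) : ℝ :=
  sSup {α : ℝ | ∀ x, α * distTo x (prodCode C) ≤ lineTestE C x}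

/-- Agreement-testability constant `ρ_a(⊗𝒞)`. -/
def agreeConst {F : Type*} [Field F] {m : ℕ} {n : Fin m → ℕ}
    (C : ∀ i, Set (Fin (n i) → F)) : ℝ :=
  sSup {α : ℝ | ∀ c : Fin m → ((∀ j, Fin (n j)) → F),
    (∀ i, c i ∈ axisCode C i) → ∃ z ∈ prodCode C,
      α * ((∑ i, lineWt (c i - z) i) / (m : ℝ)) ≤
        (∑ i, ∑ j, normWt (c i - c j)) / ((m : ℝ) ^ 2)}

/-- `C^{⊗k}` on the grid `[n]^k`. -/
def tensorPow {F : Type*} {n : ℕ} (C : Set (Fin n → F)) (k : ℕ) :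
    Set ((Fin k → Fin n) → F) :=
  {x | ∀ (i : Fin k) (y : Fin k → Fin n), (fun s => x (Function.update y i s)) ∈ C}

/-- Restriction of a word to the axis-parallel `k`-flat determined by the axes
`e : Fin k ↪ Fin m` and base point `y`. -/
def flatRestrict {F : Type*} {n m k : ℕ} (x : (Fin m → Fin n) → F)
    (e : Fin k ↪ Fin m) (y : Fin m → Fin n) : (Fin k → Fin n) → F :=
  fun z => x (fun j => if h : ∃ l, e l = j then z h.choose else y j)

/-- Expected distance under the axis-parallel `k`-flat test `T_m^k` for `C^{⊗m}`. -/
def flatTestE {F : Type*} [Field F] {n : ℕ} (C : Set (Fin n → F)) (m k : ℕ)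
    (x : (Fin m → Fin n) → F) : ℝ :=
  (∑ e : Fin k ↪ Fin m, ∑ y : Fin m → Fin n,
      distTo (flatRestrict x e y) (tensorPow C k)) /
    ((Fintype.card (Fin k ↪ Fin m) : ℝ) * (Fintype.card (Fin m → Fin n) : ℝ))

/-- Robustness constant `ρ_r(T_m^k, C^{⊗m})`. -/
def flatRobustConst {F : Type*} [Field F] {n : ℕ} (C : Set (Fin n → F)) (m k : ℕ) : ℝ :=
  sSup {α : ℝ | ∀ x : (Fin m → Fin n) → F,
    α * distTo x (tensorPow C m) ≤ flatTestE C m k x}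

/-- The polynomial `Σ aᵢ xⁱ` of a word of length `n`. -/
def wordPoly {F : Type*} [CommSemiring F] {n : ℕ} (a : Fin n → F) : Polynomial F :=
  ∑ i, Polynomial.C (a i) * Polynomial.X ^ (i : ℕ)

/-- The cyclic code of length `n` with check polynomial `p`. -/
def cyclicCode {F : Type*} [CommRing F] (n : ℕ) (p : Polynomial F) : Set (Fin n → F) :=
  {a | (Polynomial.X ^ n - 1) ∣ p * wordPoly a}

/-- Check polynomial `(x-1)(x-ω)⋯(x-ω^{k-1})` of the primitive Reed–Solomon code. -/
def rsCheck {F : Type*} [CommRing F] (k : ℕ) (ω : F) : Polynomial F :=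
  ∏ i ∈ Finset.range k, (Polynomial.X - Polynomial.C (ω ^ i))

/-- The primitive Reed–Solomon evaluation code of degree `< k` at the nonzero points. -/
def evalRS (F : Type*) [Field F] [Fintype F] (k : ℕ) : Set (Fˣ → F) :=
  {c | ∃ p : Polynomial F, p.degree < (k : ℕ) ∧ ∀ a : Fˣ, c a = p.eval (a : F)}

/-- Words on `ι₁ × ι₂` all of whose columns lie in `S`. -/
def colCode {ι₁ ι₂ F : Type*} (S : Set (ι₁ → F)) : Set (ι₁ × ι₂ → F) :=
  {x | ∀ j, (fun i => x (i, j)) ∈ S}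

/-- Words on `ι₁ × ι₂` all of whose rows lie in `S`. -/
def rowCode {ι₁ ι₂ F : Type*} (S : Set (ι₂ → F)) : Set (ι₁ × ι₂ → F) :=
  {x | ∀ i, (fun j => x (i, j)) ∈ S}

/-- The multivariate polynomial `Σ_y x_y ∏ᵢ Xᵢ^{yᵢ}` of a word on the grid `[n]^m`. -/
def wordPolyMv {F : Type*} [CommSemiring F] {m n : ℕ} (x : (Fin m → Fin n) → F) :
    MvPolynomial (Fin m) F :=
  ∑ y : Fin m → Fin n, MvPolynomial.C (x y) * ∏ i, MvPolynomial.X i ^ ((y i : ℕ))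

lemma ps_coeff_sum {R : Type*} [CommRing R] {N : ℕ} (v : Fin N → R) (i : Fin N) :
    (∑ j, C (v j) * X ^ (j : ℕ) : R[X]).coeff i = v i := by
  rw [finsetSum_coeff, Finset.sum_eq_single i]
  · simp
  · intro b _ hb
    rw [coeff_C_mul, coeff_X_pow, if_neg, mul_zero]
    intro h; exact hb (Fin.ext h.symm)
  · simp

lemma ps_degree_sum {R : Type*} [CommRing R] {N : ℕ} (v : Fin N → R) :
    (∑ j, C (v j) * X ^ (j : ℕ) : R[X]).degree < N := by
  rw [degree_lt_iff_coeff_zero]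
  intro m hm
  rw [finsetSum_coeff]
  apply Finset.sum_eq_zero
  intro j _
  rw [coeff_C_mul, coeff_X_pow, if_neg, mul_zero]
  have := j.2
  omega

lemma ps_sum_coeff {R : Type*} [CommRing R] {N : ℕ} (p : R[X]) (hp : p.degree < N) :
    (∑ j : Fin N, C (p.coeff j) * X ^ (j : ℕ) : R[X]) = p := by
  ext i
  by_cases hi : i < N
  · exact ps_coeff_sum (fun j : Fin N => p.coeff j) ⟨i, hi⟩
  · rw [(degree_lt_iff_coeff_zero _ _).1 hp i (by omega)]
    exact (degree_lt_iff_coeff_zero _ _).1 (ps_degree_sum (fun j : Fin N => p.coeff j)) i (by omega)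

/-- The Sylvester-type columns. -/
def sylCol {R : Type*} [CommRing R] (E P : R[X]) (A a : ℕ) : Fin A ⊕ Fin a → R[X] :=
  Sum.elim (fun i => X ^ (i : ℕ) * E) (fun j => X ^ (j : ℕ) * P)

/-- The Sylvester-type matrix. -/
def sylMat {R : Type*} [CommRing R] (E P : R[X]) (A a : ℕ) :
    Matrix (Fin A ⊕ Fin a) (Fin A ⊕ Fin a) R :=
  Matrix.of fun r c => (sylCol E P A a c).coeff (finSumFinEquiv r : ℕ)

lemma sylMat_det_ne_zero {R : Type*} [CommRing R] [IsDomain R] [UniqueFactorizationMonoid R]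
    (E P : R[X]) (A : ℕ)
    (hrel : IsRelPrime E P) (hE0 : E ≠ 0) (hP : P.natDegree ≤ A) :
    (sylMat E P A E.natDegree).det ≠ 0 := by
  intro hdet
  set a := E.natDegree with ha
  obtain ⟨v, hv, hMv⟩ := Matrix.exists_mulVec_eq_zero_iff.2 hdet
  set p : R[X] := ∑ i : Fin A, C (v (Sum.inl i)) * X ^ (i : ℕ) with hp
  set q : R[X] := ∑ i : Fin a, C (v (Sum.inr i)) * X ^ (i : ℕ) with hq
  have hpd : p.degree < A := ps_degree_sum (fun i : Fin A => v (Sum.inl i))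
  have hqd : q.degree < a := ps_degree_sum (fun i : Fin a => v (Sum.inr i))
  have hEd : E.degree = a := degree_eq_natDegree hE0
  have hPd : P.degree ≤ A := natDegree_le_iff_degree_le.1 hP
  have hdeg : (p * E + q * P).degree < (A + a : ℕ) := by
    apply lt_of_le_of_lt (degree_add_le _ _)
    rw [max_lt_iff]
    constructor
    · by_cases h0 : p = 0
      · rw [h0, zero_mul, degree_zero]; exact WithBot.bot_lt_coe _
      rw [degree_mul, hEd, degree_eq_natDegree h0]
      rw [degree_eq_natDegree h0] at hpd
      norm_cast at hpd ⊢
      omega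
    · by_cases h0 : q = 0
      · rw [h0, zero_mul, degree_zero]; exact WithBot.bot_lt_coe _
      by_cases h1 : P = 0
      · rw [h1, mul_zero, degree_zero]; exact WithBot.bot_lt_coe _
      rw [degree_mul, degree_eq_natDegree h0, degree_eq_natDegree h1]
      rw [degree_eq_natDegree h0] at hqd
      norm_cast at hqd ⊢
      omega
  have hzero : p * E + q * P = 0 := by
    ext r
    by_cases hr : r < A + a
    · have := congrFun hMv (finSumFinEquiv.symm ⟨r, hr⟩)
      simp only [Matrix.mulVec, dotProduct, sylMat, Matrix.of_apply, Fintype.sum_sum_type,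
        Equiv.apply_symm_apply, sylCol, Sum.elim_inl, Sum.elim_inr, Pi.zero_apply] at this
      rw [coeff_zero, ← this, coeff_add, hp, hq, Finset.sum_mul, Finset.sum_mul,
        finsetSum_coeff, finsetSum_coeff]
      congr 1
      · apply Finset.sum_congr rfl; intro i _
        rw [mul_assoc, coeff_C_mul, mul_comm]
      · apply Finset.sum_congr rfl; intro i _
        rw [mul_assoc, coeff_C_mul, mul_comm]
    · exact (degree_lt_iff_coeff_zero _ _).1 hdeg r (by omega)
  have hdvd : E ∣ q * P := ⟨-p, by linear_combination hzero⟩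
  have hq0 : q = 0 := by
    by_contra h0
    have := degree_le_of_dvd (hrel.dvd_of_dvd_mul_right hdvd) h0
    rw [hEd] at this
    exact absurd hqd (not_lt.2 this)
  have hp0 : p = 0 := by
    rw [hq0, zero_mul, add_zero] at hzero
    exact (mul_eq_zero.1 hzero).resolve_right hE0
  apply hv
  funext c
  rcases c with i | i
  · have := ps_coeff_sum (fun i : Fin A => v (Sum.inl i)) i
    rw [← hp, hp0] at this
    simpa using this.symm
  · have := ps_coeff_sum (fun i : Fin a => v (Sum.inr i)) i
    rw [← hq, hq0] at this
    simpa using this.symm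

lemma sylMat_dvd {F : Type*} [Field F] (E P : F[X][X]) (A a d : ℕ) (hA : a + d ≤ A) (x : F) (q : F[X])
    (hq : q.natDegree ≤ d)
    (h : P.map (evalRingHom x) = E.map (evalRingHom x) * q) :
    (X - C x) ^ a ∣ (sylMat E P A a).det := by
  let B : Matrix (Fin A) (Fin a) F[X] := Matrix.of fun i j => - C ((X ^ (j : ℕ) * q).coeff i)
  let U : Matrix (Fin A ⊕ Fin a) (Fin A ⊕ Fin a) F[X] := Matrix.fromBlocks 1 B 0 1
  have hU : U.det = 1 := by
    simp [U, Matrix.det_fromBlocks_zero₂₁]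
  have hcol : ∀ r (j : Fin a), (sylMat E P A a * U) r (Sum.inr j) =
      (X ^ (j : ℕ) * (P - E * q.map C)).coeff (finSumFinEquiv r : ℕ) := by
    intro r j
    have hs : (∑ i : Fin A, C (C ((X ^ (j : ℕ) * q).coeff i)) * X ^ (i : ℕ) : F[X][X]) =
        (X ^ (j : ℕ) * q).map C := by
      have hg : (X ^ (j : ℕ) * q).natDegree < A := by
        have := natDegree_mul_le (p := (X : F[X]) ^ (j : ℕ)) (q := q)
        rw [natDegree_X_pow] at this
        have := j.2
        omega
      generalize X ^ (j : ℕ) * q = g at hg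
      have hdg : (g.map (C : F →+* F[X])).degree < A := by
        apply lt_of_le_of_lt (degree_map_le)
        apply lt_of_le_of_lt degree_le_natDegree
        exact_mod_cast hg
      have h3 := ps_sum_coeff (g.map (C : F →+* F[X])) hdg
      simp only [coeff_map] at h3
      exact h3
    have e1 : (X ^ (j : ℕ) * (P - E * q.map C) : F[X][X]) = X ^ (j : ℕ) * P
        - (X ^ (j : ℕ) * q).map C * E := by
      rw [Polynomial.map_mul, Polynomial.map_pow, map_X]; ring
    rw [e1, coeff_sub, ← hs, Finset.sum_mul, finsetSum_coeff, Matrix.mul_apply, Fintype.sum_sum_type]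
    simp only [U, B, Matrix.fromBlocks_apply₁₂, Matrix.fromBlocks_apply₂₂, Matrix.of_apply, sylMat,
      sylCol, Sum.elim_inl, Sum.elim_inr, Matrix.one_apply]
    rw [add_comm, sub_eq_add_neg, ← Finset.sum_neg_distrib]
    congr 1
    · simp
    · apply Finset.sum_congr rfl; intro i _
      rw [mul_assoc, coeff_C_mul]; ring
  have hdvd : ∀ r (j : Fin a), (X - C x) ∣ (sylMat E P A a * U) r (Sum.inr j) := by
    intro r j
    rw [hcol, dvd_iff_isRoot, IsRoot.def]
    have : eval x ((X ^ (j : ℕ) * (P - E * q.map C)).coeff (finSumFinEquiv r : ℕ)) =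
      ((X ^ (j : ℕ) * (P - E * q.map C)).map (evalRingHom x)).coeff (finSumFinEquiv r : ℕ) := by
      rw [coeff_map]; rfl
    rw [this]
    have e2 : (q.map C).map (evalRingHom x) = q := by
      rw [Polynomial.map_map]
      have : (evalRingHom x).comp C = RingHom.id F := by ext; simp
      rw [this, map_id]
    rw [Polynomial.map_mul, Polynomial.map_sub, Polynomial.map_mul, e2, h, sub_self, mul_zero, coeff_zero]
  choose N hN using hdvd
  let W : Matrix (Fin A ⊕ Fin a) (Fin A ⊕ Fin a) F[X] := Matrix.of fun r c =>
    Sum.elim (fun i => (sylMat E P A a * U) r (Sum.inl i)) (fun j => N r j) c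
  let v : Fin A ⊕ Fin a → F[X] := Sum.elim (fun _ => 1) (fun _ => X - C x)
  have hfac : sylMat E P A a * U = Matrix.of fun r c => v c * W r c := by
    ext1 r c
    rcases c with i | j
    · simp [v, W]
    · simpa [v, W] using hN r j
  have := congrArg Matrix.det hfac
  rw [Matrix.det_mul, hU, mul_one, Matrix.det_mul_row] at this
  rw [this]
  apply Dvd.dvd.mul_right
  simp [v]

lemma sylMat_deg {F : Type*} [Field F] (E P : F[X][X]) (A a b c : ℕ)
    (hE : ∀ j, (E.coeff j).natDegree ≤ b) (hP : ∀ j, (P.coeff j).natDegree ≤ c) :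
    (sylMat E P A a).det.natDegree ≤ A * b + a * c := by
  rw [Matrix.det_apply]
  apply natDegree_sum_le_of_forall_le
  intro σ _
  refine le_trans (natDegree_smul_le _ _) (le_trans (natDegree_prod_le _ _) ?_)
  rw [Fintype.sum_sum_type]
  apply add_le_add
  · refine le_trans (Finset.sum_le_card_nsmul _ _ b ?_) (by simp)
    intro i _
    simp only [sylMat, sylCol, Matrix.of_apply, Sum.elim_inl, coeff_X_pow_mul']
    split_ifs
    · exact hE _
    · simp
  · refine le_trans (Finset.sum_le_card_nsmul _ _ c ?_) (by simp)
    intro i _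
    simp only [sylMat, sylCol, Matrix.of_apply, Sum.elim_inr, coeff_X_pow_mul']
    split_ifs
    · exact hP _
    · simp

lemma ps_half {F : Type*} [Field F] (E P : F[X][X]) (hrel : IsRelPrime E P) (hE0 : E ≠ 0)
    (α d β b : ℕ) (hα : E.natDegree ≤ α) (hE : ∀ j, (E.coeff j).natDegree ≤ b)
    (hP : P.natDegree ≤ α + d) (hPc : ∀ j, (P.coeff j).natDegree ≤ β + d)
    (A : Finset F) (q : F → F[X]) (hq : ∀ x ∈ A, (q x).natDegree ≤ d)
    (h : ∀ x ∈ A, P.map (evalRingHom x) = E.map (evalRingHom x) * q x) :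
    E.natDegree * A.card ≤ (α + d) * b + E.natDegree * (β + d) := by
  have hne := sylMat_det_ne_zero E P (α + d) hrel hE0 hP
  have hdeg := sylMat_deg E P (α + d) E.natDegree b (β + d) hE hPc
  have hdvd : ∏ x ∈ A, (X - C x) ^ E.natDegree ∣ (sylMat E P (α + d) E.natDegree).det := by
    apply Finset.prod_dvd_of_coprime
    · intro x _ y _ hxy
      exact (pairwise_coprime_X_sub_C (Function.injective_id) hxy).pow
    · intro x hx
      exact sylMat_dvd E P _ _ d (by omega) x (q x) (hq x hx) (h x hx)
  have h1 := natDegree_le_of_dvd hdvd hne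
  rw [natDegree_prod _ _ (fun x _ => pow_ne_zero _ (X_sub_C_ne_zero x))] at h1
  simp only [natDegree_pow, natDegree_X_sub_C, mul_one, Finset.sum_const, smul_eq_mul] at h1
  rw [mul_comm]
  exact h1.trans hdeg

lemma ps_swap_coeff {F : Type*} [Field F] (p : F[X][X]) (i j : ℕ) :
    ((Bivariate.swap p).coeff i).coeff j = (p.coeff j).coeff i := by
  induction p using Polynomial.induction_on' with
  | add p q hp hq => simp only [map_add, coeff_add, hp, hq]
  | monomial n f =>
    induction f using Polynomial.induction_on' with
    | add p q hp hq => simp only [map_add, coeff_add, hp, hq]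
    | monomial k r =>
      rw [Bivariate.swap_monomial_monomial]
      simp only [coeff_monomial]
      by_cases h1 : k = i <;> by_cases h2 : n = j <;> simp [h1, h2, coeff_monomial]

lemma ps_swap_deg {F : Type*} [Field F] (p : F[X][X]) (b : ℕ) :
    (Bivariate.swap p).natDegree ≤ b ↔ ∀ j, (p.coeff j).natDegree ≤ b := by
  constructor
  · intro h j
    rw [natDegree_le_iff_coeff_eq_zero]
    intro N hN
    rw [← ps_swap_coeff, coeff_eq_zero_of_natDegree_lt (lt_of_le_of_lt h hN), coeff_zero]
  · intro h
    rw [natDegree_le_iff_coeff_eq_zero]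
    intro N hN
    ext j
    rw [ps_swap_coeff, coeff_eq_zero_of_natDegree_lt (lt_of_le_of_lt (h j) hN), coeff_zero]

lemma ps_swap_map {F : Type*} [Field F] (p : F[X][X]) (y : F) :
    (Bivariate.swap p).map (evalRingHom y) = p.eval (C y) := by
  induction p using Polynomial.induction_on' with
  | add p q hp hq => simp only [map_add, Polynomial.map_add, eval_add, hp, hq]
  | monomial n f =>
    rw [Bivariate.swap_monomial, Polynomial.map_mul, Polynomial.map_map, eval_monomial, map_C]
    have : (evalRingHom y).comp C = RingHom.id F := by ext; simp
    rw [this, map_id]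
    simp

lemma ps_swap_swap_map {F : Type*} [Field F] (p : F[X][X]) (x : F) :
    (Bivariate.swap p).eval (C x) = p.map (evalRingHom x) := by
  rw [← ps_swap_map, Bivariate.swap_swap_apply]

lemma ps_zero_cols {F : Type*} [Field F] [DecidableEq F] (G : F[X][X]) (hG : G ≠ 0) (A : Finset F)
    (h : ∀ x ∈ A, G.map (evalRingHom x) = 0) : A.card ≤ (Bivariate.swap G).natDegree := by
  obtain ⟨j, hj⟩ : ∃ j, G.coeff j ≠ 0 := by
    by_contra hc
    push Not at hc
    exact hG (by ext1 j; simpa using hc j)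
  have hsub : A ⊆ (G.coeff j).roots.toFinset := by
    intro x hx
    rw [Multiset.mem_toFinset, mem_roots hj, IsRoot.def]
    have := congrArg (fun p => p.coeff j) (h x hx)
    simpa [coeff_map] using this
  calc A.card ≤ (G.coeff j).roots.toFinset.card := Finset.card_le_card hsub
    _ ≤ Multiset.card (G.coeff j).roots := Multiset.toFinset_card_le _
    _ ≤ (G.coeff j).natDegree := card_roots' _
    _ ≤ _ := (ps_swap_deg G _).1 le_rfl j

lemma ps_relprime_swap {F : Type*} [Field F] (E P : F[X][X]) (h : IsRelPrime E P) :
    IsRelPrime (Bivariate.swap E) (Bivariate.swap P) := by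
  intro d h1 h2
  have h1' := map_dvd (Bivariate.swap (R := F)) h1
  have h2' := map_dvd (Bivariate.swap (R := F)) h2
  rw [Bivariate.swap_swap_apply] at h1' h2'
  have := h h1' h2'
  exact (MulEquiv.isUnit_map (Bivariate.swap (R := F))).1 this

/-- One-sided estimate after removing the common factor `G`. -/
lemma ps_side {F : Type*} [Field F] [DecidableEq F] (G E P : F[X][X]) (hG : G ≠ 0) (hE : E ≠ 0)
    (hrel : IsRelPrime E P) (a d : ℕ)
    (hEY : (G * E).natDegree ≤ a) (hEX : (Bivariate.swap (G * E)).natDegree ≤ a)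
    (hPY : (G * P).natDegree ≤ a + d) (hPX : (Bivariate.swap (G * P)).natDegree ≤ a + d)
    (A : Finset F) (q : F → F[X]) (hq : ∀ x ∈ A, (q x).natDegree ≤ d)
    (h : ∀ x ∈ A, (G * P).map (evalRingHom x) = (G * E).map (evalRingHom x) * q x)
    (hA : 2 * a + 2 * d < A.card) (hle : (Bivariate.swap E).natDegree ≤ E.natDegree) :
    E.natDegree = 0 := by
  have hsw : ∀ f : F[X][X], f ≠ 0 → Bivariate.swap f ≠ 0 := by
    intro f hf h0
    exact hf ((map_eq_zero_iff _ (Bivariate.swap (R := F)).injective).1 h0)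
  set g := (Bivariate.swap G).natDegree with hg
  set b := (Bivariate.swap E).natDegree with hb
  set A' := A.filter (fun x => G.map (evalRingHom x) ≠ 0) with hA'
  have hcard : A.card ≤ A'.card + g := by
    rw [← Finset.card_filter_add_card_filter_not (s := A) (fun x => G.map (evalRingHom x) ≠ 0)]
    apply Nat.add_le_add_left
    apply ps_zero_cols G hG
    intro x hx
    simpa using (Finset.mem_filter.1 hx).2
  have e1 : G.natDegree + E.natDegree ≤ a := by rwa [natDegree_mul hG hE] at hEY
  have e2 : g + b ≤ a := by
    rwa [map_mul, natDegree_mul (hsw _ hG) (hsw _ hE)] at hEX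
  have e3 : P.natDegree ≤ (a - G.natDegree) + d := by
    by_cases hP : P = 0
    · simp [hP]
    rw [natDegree_mul hG hP] at hPY
    omega
  have e4 : (Bivariate.swap P).natDegree ≤ (a - g) + d := by
    by_cases hP : P = 0
    · simp [hP]
    rw [map_mul, natDegree_mul (hsw _ hG) (hsw _ hP)] at hPX
    omega
  have key := ps_half E P hrel hE (a - G.natDegree) d (a - g) b (by omega)
    ((ps_swap_deg E b).1 le_rfl) e3 ((ps_swap_deg P _).1 e4) A' q
    (fun x hx => hq x (Finset.mem_filter.1 hx).1) (by
      intro x hx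
      obtain ⟨hx1, hx2⟩ := Finset.mem_filter.1 hx
      have := h x hx1
      rw [Polynomial.map_mul, Polynomial.map_mul, mul_assoc] at this
      exact mul_left_cancel₀ hx2 this)
  by_contra h0
  have h1 : (a - G.natDegree + d) * b ≤ E.natDegree * (a - G.natDegree + d) := by
    rw [mul_comm]; exact Nat.mul_le_mul_right _ hle
  have h2 : E.natDegree * A'.card ≤ E.natDegree * ((a - G.natDegree + d) + (a - g + d)) := by
    rw [mul_add]; omega
  have h3 := Nat.le_of_mul_le_mul_left h2 (Nat.pos_of_ne_zero h0)
  omega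

lemma ps_unit {F : Type*} [Field F] (E : F[X][X]) (hE : E ≠ 0) (h1 : E.natDegree = 0)
    (h2 : (Bivariate.swap E).natDegree = 0) : IsUnit E := by
  rw [natDegree_eq_zero] at h1
  obtain ⟨e, rfl⟩ := h1
  have h3 := (ps_swap_deg (C e) 0).1 (le_of_eq h2) 0
  rw [coeff_C_zero] at h3
  obtain ⟨u, rfl⟩ := natDegree_eq_zero.1 (Nat.le_zero.1 h3)
  have : u ≠ 0 := by rintro rfl; simp at hE
  exact ((this.isUnit.map C).map C)

lemma ps_div {F : Type*} [Field F] [DecidableEq F] (E P : F[X][X]) (hE : E ≠ 0) (a d : ℕ)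
    (hEY : E.natDegree ≤ a) (hEX : ∀ j, (E.coeff j).natDegree ≤ a)
    (hPY : P.natDegree ≤ a + d) (hPX : ∀ j, (P.coeff j).natDegree ≤ a + d)
    (A B : Finset F) (hA : 2 * a + 2 * d < A.card) (hB : 2 * a + 2 * d < B.card)
    (q r : F → F[X]) (hq : ∀ x ∈ A, (q x).natDegree ≤ d) (hr : ∀ y ∈ B, (r y).natDegree ≤ d)
    (h1 : ∀ x ∈ A, P.map (evalRingHom x) = E.map (evalRingHom x) * q x)
    (h2 : ∀ y ∈ B, P.eval (C y) = E.eval (C y) * r y) : E ∣ P := by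
  rw [← ps_swap_deg] at hEX hPX
  obtain ⟨E', P', G, hrel, rfl, rfl⟩ := UniqueFactorizationMonoid.exists_reduced_factors E hE P
  have hG : G ≠ 0 := left_ne_zero_of_mul hE
  have hE' : E' ≠ 0 := right_ne_zero_of_mul hE
  have hsw : ∀ f : F[X][X], f ≠ 0 → Bivariate.swap f ≠ 0 := by
    intro f hf h0
    exact hf ((map_eq_zero_iff _ (Bivariate.swap (R := F)).injective).1 h0)
  have hu : IsUnit E' := by
    rcases le_total (Bivariate.swap E').natDegree E'.natDegree with hle | hle
    · have := ps_side G E' P' hG hE' hrel a d hEY hEX hPY hPX A q hq h1 hA hle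
      exact ps_unit E' hE' this (by omega)
    · have m1 : Bivariate.swap G * Bivariate.swap E' = Bivariate.swap (G * E') :=
        (map_mul _ _ _).symm
      have m2 : Bivariate.swap G * Bivariate.swap P' = Bivariate.swap (G * P') :=
        (map_mul _ _ _).symm
      have := ps_side (Bivariate.swap G) (Bivariate.swap E') (Bivariate.swap P') (hsw _ hG)
        (hsw _ hE') (ps_relprime_swap _ _ hrel) a d
        (by rw [m1]; exact hEX) (by rw [m1, Bivariate.swap_swap_apply]; exact hEY)
        (by rw [m2]; exact hPX) (by rw [m2, Bivariate.swap_swap_apply]; exact hPY)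
        B r hr (by
          intro y hy
          rw [m1, m2, ps_swap_map, ps_swap_map]
          exact h2 y hy) hB (by rw [Bivariate.swap_swap_apply]; exact hle)
      exact ps_unit E' hE' (by omega) this
  exact mul_dvd_mul_left G hu.dvd

lemma ps_locator {F : Type*} [Field F] {n : ℕ} (ev : Fin n → F) (bad : Finset (Fin n × Fin n))
    (a : ℕ) (hbad : bad.card < (a + 1) ^ 2) :
    ∃ E : F[X][X], E ≠ 0 ∧ E.natDegree ≤ a ∧ (∀ j, (E.coeff j).natDegree ≤ a) ∧
      ∀ b ∈ bad, (E.eval (C (ev b.2))).eval (ev b.1) = 0 := by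
  classical
  let M : Matrix bad (Fin (a + 1) × Fin (a + 1)) F :=
    Matrix.of fun b uv => ev b.1.1 ^ (uv.1 : ℕ) * ev b.1.2 ^ (uv.2 : ℕ)
  have hker : LinearMap.ker M.mulVecLin ≠ ⊥ := by
    apply LinearMap.ker_ne_bot_of_finrank_lt
    simp only [Module.finrank_fintype_fun_eq_card, Fintype.card_coe, Fintype.card_prod,
      Fintype.card_fin]
    rw [← sq]; exact hbad
  obtain ⟨e, he, he0⟩ := (Submodule.ne_bot_iff _).1 hker
  rw [LinearMap.mem_ker, Matrix.mulVecLin_apply] at he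
  let g : Fin (a + 1) → F[X] := fun v => ∑ u : Fin (a + 1), C (e (u, v)) * X ^ (u : ℕ)
  let E : F[X][X] := ∑ v : Fin (a + 1), C (g v) * X ^ (v : ℕ)
  have hgd : ∀ v, (g v).natDegree ≤ a := by
    intro v
    have h := ps_degree_sum (fun u => e (u, v))
    rw [natDegree_le_iff_coeff_eq_zero]
    intro N hN
    exact (degree_lt_iff_coeff_zero _ _).1 h N (by omega)
  have hEdeg : E.degree < (a + 1 : ℕ) := ps_degree_sum g
  refine ⟨E, ?_, ?_, ?_, ?_⟩
  · intro hE
    apply he0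
    funext uv
    have h1 := ps_coeff_sum g uv.2
    have h2 := ps_coeff_sum (fun u => e (u, uv.2)) uv.1
    change E.coeff _ = _ at h1
    rw [hE, coeff_zero] at h1
    change (g uv.2).coeff _ = _ at h2
    rw [← h1, coeff_zero] at h2
    exact h2.symm
  · rw [natDegree_le_iff_coeff_eq_zero]
    intro N hN
    exact (degree_lt_iff_coeff_zero _ _).1 hEdeg N (by omega)
  · intro j
    by_cases hj : j < a + 1
    · have h1 := ps_coeff_sum g ⟨j, hj⟩
      change E.coeff j = _ at h1
      rw [h1]; exact hgd _
    · rw [(degree_lt_iff_coeff_zero _ _).1 hEdeg j (by omega)]; simp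
  · intro b hb
    have h := congrFun he ⟨b, hb⟩
    simp only [Matrix.mulVec, dotProduct, M, Matrix.of_apply, Pi.zero_apply,
      Fintype.sum_prod_type] at h
    rw [← h]
    simp only [E, g, eval_finsetSum, eval_mul, eval_C, eval_pow, eval_X]
    rw [Finset.sum_comm]
    apply Finset.sum_congr rfl; intro v _
    rw [Finset.sum_mul]
    apply Finset.sum_congr rfl; intro u _
    ring

lemma ps_core {F : Type*} [Field F] {n k a : ℕ} (ev : Fin n → F) (hev : Function.Injective ev)
    (p q : Fin n → F[X]) (hp : ∀ j, (p j).degree < k) (hq : ∀ j, (q j).degree < k)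
    (bad : Finset (Fin n × Fin n))
    (hbad : ∀ i j, (i, j) ∉ bad → (p j).eval (ev i) = (q i).eval (ev j))
    (hcard : bad.card < (a + 1) ^ 2) (hk : 1 ≤ k) (hn : 2 * a + 2 * (k - 1) < n) :
    ∃ GX GY : Finset (Fin n), n ≤ GX.card + a ∧ n ≤ GY.card + a ∧
      ∀ i ∈ GX, ∀ j ∈ GY, (p j).eval (ev i) = (q i).eval (ev j) := by
  classical
  obtain ⟨E, hE, hEY, hEX, hE0⟩ := ps_locator ev bad a hcard
  have hnd : ∀ f : F[X], f.degree < k → f.natDegree ≤ k - 1 := by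
    intro f hf
    rw [natDegree_le_iff_coeff_eq_zero]
    intro N hN
    exact (degree_lt_iff_coeff_zero _ _).1 hf N (by omega)
  have hagree : ∀ i j, (E.eval (C (ev j))).eval (ev i) * (p j).eval (ev i) =
      (E.eval (C (ev j))).eval (ev i) * (q i).eval (ev j) := by
    intro i j
    by_cases hb : (i, j) ∈ bad
    · rw [hE0 _ hb, zero_mul, zero_mul]
    · rw [hbad i j hb]
  obtain ⟨J, -, hJ⟩ := Finset.exists_subset_card_eq (s := (Finset.univ : Finset (Fin n)))
    (n := a + k) (by rw [Finset.card_fin]; omega)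
  have hEYdeg : ∀ y : F, (E.eval (C y)).natDegree ≤ a := by
    intro y
    rw [eval_eq_sum_range]
    apply natDegree_sum_le_of_forall_le
    intro i _
    refine natDegree_mul_le.trans ?_
    rw [← C_pow, natDegree_C, add_zero]
    exact hEX i
  have hrowdeg : ∀ j, (E.eval (C (ev j)) * p j).natDegree ≤ a + (k - 1) := fun j =>
    natDegree_mul_le.trans (add_le_add (hEYdeg _) (hnd _ (hp j)))
  let P : F[X][X] := ∑ j ∈ J, C (E.eval (C (ev j)) * p j) * (Lagrange.basis J ev j).map C
  have hbdeg : ∀ j ∈ J, (Lagrange.basis J ev j).natDegree ≤ a + (k - 1) := by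
    intro j hj
    rw [natDegree_le_iff_degree_le, Lagrange.degree_basis hev.injOn hj, hJ]
    apply le_of_eq
    congr 1
    omega
  have hPY : P.natDegree ≤ a + (k - 1) := by
    apply natDegree_sum_le_of_forall_le
    intro j hj
    refine natDegree_mul_le.trans ?_
    rw [natDegree_C, zero_add]
    exact natDegree_map_le.trans (hbdeg j hj)
  have hPX : ∀ t, (P.coeff t).natDegree ≤ a + (k - 1) := by
    intro t
    rw [finsetSum_coeff]
    apply natDegree_sum_le_of_forall_le
    intro j hj
    rw [coeff_C_mul, coeff_map]
    refine natDegree_mul_le.trans ?_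
    rw [natDegree_C, add_zero]
    exact hrowdeg j
  have hProw0 : ∀ j ∈ J, P.eval (C (ev j)) = E.eval (C (ev j)) * p j := by
    intro j hj
    simp only [P, eval_finsetSum, eval_mul, eval_C]
    rw [Finset.sum_eq_single j]
    · rw [eval_map_apply, Lagrange.eval_basis_self hev.injOn hj, C_1, mul_one]
    · intro i hi hij
      rw [eval_map_apply, Lagrange.eval_basis_of_ne hij hj, C_0, mul_zero]
    · intro h; exact absurd hj h
  have hmapE : ∀ x, (E.map (evalRingHom x)).natDegree ≤ a := fun x => natDegree_map_le.trans hEY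
  have hlt : ∀ f : F[X], f.natDegree ≤ a + (k - 1) → f.degree < (a + k : ℕ) := by
    intro f hf
    apply lt_of_le_of_lt degree_le_natDegree
    norm_cast
    omega
  have hcol : ∀ i, P.map (evalRingHom (ev i)) = E.map (evalRingHom (ev i)) * q i := by
    intro i
    apply eq_of_degrees_lt_of_eval_index_eq J (v := ev) hev.injOn
    · rw [hJ]; exact hlt _ (natDegree_map_le.trans hPY)
    · rw [hJ]; exact hlt _ (natDegree_mul_le.trans (add_le_add (hmapE _) (hnd _ (hq i))))
    · intro j hj
      rw [eval_mul, map_evalRingHom_eval, map_evalRingHom_eval, evalEval, evalEval, hProw0 j hj,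
        eval_mul, hagree]
  have hrow : ∀ j, P.eval (C (ev j)) = E.eval (C (ev j)) * p j := by
    intro j
    apply eq_of_degrees_lt_of_eval_index_eq J (v := ev) hev.injOn
    · rw [hJ]
      apply hlt
      rw [eval_eq_sum_range]
      apply natDegree_sum_le_of_forall_le
      intro i _
      refine natDegree_mul_le.trans ?_
      rw [← C_pow, natDegree_C, add_zero]
      exact hPX i
    · rw [hJ]; exact hlt _ (hrowdeg j)
    · intro i hi
      have := congrArg (eval (ev j)) (hcol i)
      rw [eval_mul, map_evalRingHom_eval, map_evalRingHom_eval, evalEval, evalEval] at this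
      rw [this, eval_mul, hagree]
  have : Nonempty (Fin n) := ⟨⟨0, by omega⟩⟩
  have hinv : ∀ i, Function.invFun ev (ev i) = i := Function.leftInverse_invFun hev
  have hdiv : E ∣ P := by
    apply ps_div E P hE a (k - 1) hEY hEX hPY hPX (Finset.univ.image ev) (Finset.univ.image ev)
      (by rw [Finset.card_image_of_injective _ hev, Finset.card_fin]; exact hn)
      (by rw [Finset.card_image_of_injective _ hev, Finset.card_fin]; exact hn)
      (fun x => q (Function.invFun ev x)) (fun x => p (Function.invFun ev x))
      (fun x _ => hnd _ (hq _)) (fun x _ => hnd _ (hp _))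
    · intro x hx
      obtain ⟨i, -, rfl⟩ := Finset.mem_image.1 hx
      rw [hinv]; exact hcol i
    · intro x hx
      obtain ⟨i, -, rfl⟩ := Finset.mem_image.1 hx
      rw [hinv]; exact hrow i
  obtain ⟨Q, hQ⟩ := hdiv
  have count : ∀ E' : F[X][X], E' ≠ 0 → (Bivariate.swap E').natDegree ≤ a →
      n ≤ (Finset.univ.filter (fun i => E'.map (evalRingHom (ev i)) ≠ 0)).card + a := by
    intro E' hE' hd
    have h1 := Finset.card_filter_add_card_filter_not (s := (Finset.univ : Finset (Fin n)))
      (fun i => E'.map (evalRingHom (ev i)) ≠ 0)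
    rw [Finset.card_fin] at h1
    have h2 := ps_zero_cols E' hE' ((Finset.univ.filter
      (fun i => ¬ (E'.map (evalRingHom (ev i)) ≠ 0))).image ev) (by
        intro x hx
        obtain ⟨i, hi, rfl⟩ := Finset.mem_image.1 hx
        simpa using (Finset.mem_filter.1 hi).2)
    rw [Finset.card_image_of_injective _ hev] at h2
    omega
  refine ⟨Finset.univ.filter (fun i => E.map (evalRingHom (ev i)) ≠ 0),
    Finset.univ.filter (fun i => (Bivariate.swap E).map (evalRingHom (ev i)) ≠ 0),
    count E hE ((ps_swap_deg E a).2 hEX), count _ ?_ ?_, ?_⟩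
  · intro h0
    exact hE ((map_eq_zero_iff _ (Bivariate.swap (R := F)).injective).1 h0)
  · rw [Bivariate.swap_swap_apply]; exact hEY
  · intro i hi j hj
    have hi' := (Finset.mem_filter.1 hi).2
    have hj' := (Finset.mem_filter.1 hj).2
    rw [ps_swap_map] at hj'
    have h1 : Q.map (evalRingHom (ev i)) = q i := by
      have := hcol i
      rw [hQ, Polynomial.map_mul] at this
      exact mul_left_cancel₀ hi' this
    have h2 : Q.eval (C (ev j)) = p j := by
      have := hrow j
      rw [hQ, eval_mul] at this
      exact mul_left_cancel₀ hj' this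
    rw [← h1, ← h2, map_evalRingHom_eval]

section RSgrid
open scoped Classical

/-- Number of positions where two words differ. -/
def hd {ι F : Type*} [Fintype ι] (f g : ι → F) : ℕ :=
  (Finset.univ.filter (fun y => f y ≠ g y)).card

lemma hd_comm {ι F : Type*} [Fintype ι] (f g : ι → F) : hd f g = hd g f := by
  unfold hd; congr 1; ext y; simp [eq_comm]

lemma hd_tri {ι F : Type*} [Fintype ι] (f g h : ι → F) : hd f h ≤ hd f g + hd g h := by
  unfold hd
  refine le_trans (Finset.card_le_card ?_) (Finset.card_union_le _ _)
  intro y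
  simp only [Finset.mem_filter, Finset.mem_univ, true_and, Finset.mem_union]
  intro hne
  by_contra hc
  push Not at hc
  exact hne (hc.1.trans hc.2)

lemma hd_le_card {ι F : Type*} [Fintype ι] (f g : ι → F) : hd f g ≤ Fintype.card ι :=
  Finset.card_le_univ _

/-- Evaluation code of polynomials of degree `< k` at the points `ev`. -/
def RS {F : Type*} [Field F] {n : ℕ} (k : ℕ) (ev : Fin n → F) : Set (Fin n → F) :=
  {c | ∃ p : F[X], p.degree < k ∧ ∀ s, c s = p.eval (ev s)}

/-- All axis-`i` lines lie in `C`. -/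
def onAx {F : Type*} {m n : ℕ} (C : Set (Fin n → F)) (i : Fin m) (f : (Fin m → Fin n) → F) : Prop :=
  ∀ y, (fun s => f (Function.update y i s)) ∈ C

variable {F : Type*} [Field F] {n k m : ℕ} {ev : Fin n → F}

lemma rs_zero : (0 : Fin n → F) ∈ RS k ev := ⟨0, by simp, by simp⟩

lemma rs_smul {c : Fin n → F} (a : F) (hc : c ∈ RS k ev) : (fun s => a * c s) ∈ RS k ev := by
  obtain ⟨p, hp, h⟩ := hc
  refine ⟨C a * p, ?_, fun s => by simp [h]⟩
  rw [degree_lt_iff_coeff_zero] at hp ⊢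
  intro N hN
  rw [coeff_C_mul, hp N hN, mul_zero]

lemma rs_sub {c c' : Fin n → F} (hc : c ∈ RS k ev) (hc' : c' ∈ RS k ev) :
    (fun s => c s - c' s) ∈ RS k ev := by
  obtain ⟨p, hp, h⟩ := hc
  obtain ⟨p', hp', h'⟩ := hc'
  exact ⟨p - p', lt_of_le_of_lt (degree_sub_le _ _) (max_lt hp hp'), fun s => by simp [h, h']⟩

lemma rs_sum {ι : Type*} (S : Finset ι) (c : ι → Fin n → F) (hc : ∀ i ∈ S, c i ∈ RS k ev) :
    (fun s => ∑ i ∈ S, c i s) ∈ RS k ev := by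
  induction S using Finset.induction_on with
  | empty =>
    simp only [Finset.sum_empty]
    exact rs_zero
  | insert a S ha ih =>
    obtain ⟨p, hp, h⟩ := hc a (Finset.mem_insert_self _ _)
    obtain ⟨p', hp', h'⟩ := ih (fun i hi => hc i (Finset.mem_insert_of_mem hi))
    refine ⟨p + p', lt_of_le_of_lt (degree_add_le _ _) (max_lt hp hp'), fun s => ?_⟩
    show ∑ i ∈ insert a S, c i s = _
    rw [Finset.sum_insert ha, h, eval_add, ← h']

lemma rs_eq (hev : Function.Injective ev) {c c' : Fin n → F} (hc : c ∈ RS k ev) (hc' : c' ∈ RS k ev)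
    (S : Finset (Fin n)) (hS : k ≤ S.card) (h : ∀ s ∈ S, c s = c' s) : c = c' := by
  obtain ⟨p, hp, hh⟩ := hc
  obtain ⟨p', hp', hh'⟩ := hc'
  have : p = p' := by
    apply eq_of_degrees_lt_of_eval_index_eq S (v := ev) hev.injOn
    · exact lt_of_lt_of_le hp (by exact_mod_cast hS)
    · exact lt_of_lt_of_le hp' (by exact_mod_cast hS)
    · intro s hs; rw [← hh, ← hh', h s hs]
  funext s
  rw [hh, hh', this]

lemma rs_basis (hev : Function.Injective ev) (S : Finset (Fin n)) (hS : S.card = k) :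
    ∃ L : Fin n → Fin n → F, (∀ s ∈ S, L s ∈ RS k ev) ∧
      ∀ c ∈ RS k ev, ∀ x, c x = ∑ s ∈ S, L s x * c s := by
  refine ⟨fun s x => (Lagrange.basis S ev s).eval (ev x), ?_, ?_⟩
  · intro s hs
    refine ⟨_, ?_, fun x => rfl⟩
    rw [Lagrange.degree_basis hev.injOn hs, hS]
    have : 0 < k := by rw [← hS]; exact Finset.card_pos.2 ⟨s, hs⟩
    exact_mod_cast (by omega : k - 1 < k)
  · rintro c ⟨p, hp, h⟩ x
    have := Lagrange.eq_interpolate (s := S) hev.injOn (by rw [hS]; exact hp)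
    have h2 := congrArg (eval (ev x)) this
    rw [Lagrange.interpolate_apply, eval_finsetSum] at h2
    rw [h, h2]
    apply Finset.sum_congr rfl
    intro s _
    show _ = eval (ev x) (Lagrange.basis S ev s) * c s
    rw [eval_mul, eval_C, h, mul_comm]

lemma rs_glue (hev : Function.Injective ev) (i₀ i₁ : Fin m) (h01 : i₁ ≠ i₀)
    (Q : Fin m → (Fin m → Fin n) → F) (hQ : ∀ i j, j ≠ i → onAx (RS k ev) j (Q i))
    (G : Fin m → Finset (Fin n)) (hG : ∀ i, k ≤ (G i).card)
    (hcons : ∀ i j, i ≠ j → ∀ y, y i ∈ G i → y j ∈ G j → Q i y = Q j y) :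
    ∃ z : (Fin m → Fin n) → F, (∀ i, onAx (RS k ev) i z) ∧ ∀ i y, y i ∈ G i → Q i y = z y := by
  obtain ⟨I, hI, hIc⟩ := Finset.exists_subset_card_eq (hG i₀)
  obtain ⟨L, hL, hL'⟩ := rs_basis hev I hIc
  let z : (Fin m → Fin n) → F := fun y => ∑ s ∈ I, L s (y i₀) * Q i₀ (Function.update y i₀ s)
  have hz : ∀ i, onAx (RS k ev) i z := by
    intro i y
    by_cases hi : i = i₀
    · subst hi
      simp only [z, Function.update_self, Function.update_idem]
      apply rs_sum
      intro s hs
      have := rs_smul (Q i (Function.update y i s)) (hL s hs)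
      simpa only [mul_comm] using this
    · simp only [z]
      apply rs_sum
      intro s hs
      have := rs_smul (L s (y i₀)) (hQ i₀ i hi (Function.update y i₀ s))
      convert this using 2 with t
      rw [Function.update_of_ne (Ne.symm hi), Function.update_comm hi]
  have hne : ∀ j, j ≠ i₀ → ∀ y, y j ∈ G j → Q j y = z y := by
    intro j hj y hy
    have h1 := hL' _ (hQ j i₀ (Ne.symm hj) y) (y i₀)
    simp only [Function.update_eq_self] at h1
    rw [h1]
    apply Finset.sum_congr rfl
    intro s hs
    congr 1
    apply hcons j i₀ hj
    · rw [Function.update_of_ne hj]; exact hy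
    · rw [Function.update_self]; exact hI hs
  refine ⟨z, hz, ?_⟩
  intro j y hy
  by_cases hj : j = i₀
  · subst hj
    have := rs_eq hev (hQ j i₁ h01 y) (hz i₁ y) (G i₁) (hG i₁) (by
      intro s hs
      rw [← hne i₁ h01 _ (by rw [Function.update_self]; exact hs)]
      apply hcons j i₁ (Ne.symm h01)
      · rw [Function.update_of_ne (Ne.symm h01)]; exact hy
      · rw [Function.update_self]; exact hs)
    have := congrFun this (y i₁)
    simpa only [Function.update_eq_self] using this
  · exact hne j hj y hy

lemma card_slab (i : Fin m) (B : Finset (Fin n)) :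
    (Finset.univ.filter (fun y : Fin m → Fin n => y i ∈ B)).card = B.card * n ^ (m - 1) := by
  have : (Finset.univ.filter (fun y : Fin m → Fin n => y i ∈ B)) =
      Fintype.piFinset (fun j => if j = i then B else Finset.univ) := by
    ext y
    simp only [Finset.mem_filter, Finset.mem_univ, true_and, Fintype.mem_piFinset]
    constructor
    · intro h j
      split_ifs with hj
      · rw [hj]; exact h
      · simp
    · intro h; simpa using h i
  rw [this, Fintype.card_piFinset, ← Finset.mul_prod_erase _ _ (Finset.mem_univ i)]
  simp only [if_true]
  congr 1
  rw [Finset.prod_congr rfl (g := fun _ => n)]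
  · simp
  · intro j hj
    rw [if_neg (Finset.ne_of_mem_erase hj)]; simp

lemma hd_slab {F : Type*} (f g : (Fin m → Fin n) → F) (i : Fin m) (B : Finset (Fin n))
    (h : ∀ y, f y ≠ g y → y i ∈ B) : hd f g ≤ B.card * n ^ (m - 1) := by
  rw [← card_slab i B]
  apply Finset.card_le_card
  intro y hy
  simp only [Finset.mem_filter, Finset.mem_univ, true_and] at hy ⊢
  exact h y hy

lemma fiber_le {α β : Type*} [DecidableEq β] (T : Finset α) (B : Finset β) (φ : α → β) (N : ℕ)
    (h : ∀ c ∈ B, N ≤ (T.filter (fun y => φ y = c)).card) : B.card * N ≤ T.card := by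
  have h1 := Finset.sum_card_fiberwise_eq_card_filter T B φ
  have h2 : B.card * N ≤ ∑ c ∈ B, (T.filter (fun y => φ y = c)).card := by
    rw [← smul_eq_mul]
    exact Finset.card_nsmul_le_sum _ _ _ h
  exact h2.trans (h1 ▸ Finset.card_le_card (Finset.filter_subset _ _))

/-- nonzero words have many nonzeros -/
lemma rs_wt (hev : Function.Injective ev) (hn : n = 3 * k) {c : Fin n → F} (hc : c ∈ RS k ev)
    (h0 : c ≠ 0) : 2 * k < (Finset.univ.filter (fun s => c s ≠ 0)).card := by
  by_contra hcon
  apply h0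
  have h1 := Finset.card_filter_add_card_filter_not (s := (Finset.univ : Finset (Fin n)))
    (fun s => c s ≠ 0)
  rw [Finset.card_fin] at h1
  apply rs_eq hev hc rs_zero (Finset.univ.filter (fun s => ¬ (c s ≠ 0))) (by omega)
  intro s hs
  simpa using (Finset.mem_filter.1 hs).2

lemma rs_flat (hev : Function.Injective ev) (hn : n = 3 * k) (f : (Fin m → Fin n) → F)
    (T : Finset (Fin m)) : ∀ (y : Fin m → Fin n), (∀ l ∈ T, onAx (RS k ev) l f) → f y ≠ 0 →
    k ^ T.card ≤ (Finset.univ.filter (fun y' : Fin m → Fin n =>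
      (∀ l, l ∉ T → y' l = y l) ∧ f y' ≠ 0)).card := by
  induction T using Finset.induction_on with
  | empty =>
    intro y _ hy
    simp only [Finset.card_empty, pow_zero]
    apply Finset.card_pos.2
    exact ⟨y, by simp [hy]⟩
  | insert a T ha ih =>
    intro y hT hy
    rw [Finset.card_insert_of_notMem ha, pow_succ, mul_comm]
    have hline := hT a (Finset.mem_insert_self _ _) y
    have hw := rs_wt hev hn hline (by
      intro h
      apply hy
      have := congrFun h (y a)
      simpa using this)
    have hf := fiber_le (Finset.univ.filter (fun y' : Fin m → Fin n =>
      (∀ l, l ∉ insert a T → y' l = y l) ∧ f y' ≠ 0))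
      (Finset.univ.filter (fun s => f (Function.update y a s) ≠ 0)) (fun y' => y' a) (k ^ T.card) ?_
    · exact le_trans (Nat.mul_le_mul_right _ (hw.le.trans' (by omega))) hf
    intro c hc
    refine le_trans (ih (Function.update y a c)
      (fun l hl => hT l (Finset.mem_insert_of_mem hl)) (by simpa using hc)) ?_
    apply Finset.card_le_card
    intro y'
    simp only [Finset.mem_filter, Finset.mem_univ, true_and, Finset.mem_insert, not_or]
    rintro ⟨h1, h2⟩
    refine ⟨⟨?_, h2⟩, ?_⟩
    · rintro l ⟨hl1, hl2⟩
      rw [h1 l hl2, Function.update_of_ne hl1]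
    · rw [h1 a ha, Function.update_self]

end RSgrid

section RSgrid
open scoped Classical

variable {F : Type*} [Field F] {n k m : ℕ} {ev : Fin n → F}

/-- planes `i,c` and `j,d` are inconsistent -/
def incs (Q : Fin m → (Fin m → Fin n) → F) (i : Fin m) (c : Fin n) (j : Fin m) (d : Fin n) : Prop :=
  ∃ y, y i = c ∧ y j = d ∧ Q i y ≠ Q j y

def badp (k : ℕ) (Q : Fin m → (Fin m → Fin n) → F) (i j : Fin m) : Finset (Fin n) :=
  Finset.univ.filter (fun c => k ≤ (Finset.univ.filter (fun d => incs Q i c j d)).card)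

lemma badp_card (hev : Function.Injective ev) (hn : n = 3 * k)
    (Q : Fin m → (Fin m → Fin n) → F) (hQ : ∀ i j, j ≠ i → onAx (RS k ev) j (Q i))
    (i j : Fin m) (hij : i ≠ j) (hm : 2 ≤ m) :
    (badp k Q i j).card * k ^ (m - 1) ≤ hd (Q i) (Q j) := by
  unfold hd
  apply fiber_le _ _ (fun y => y i)
  intro c hc
  have hc' := (Finset.mem_filter.1 hc).2
  have h2 := fiber_le ((Finset.univ.filter (fun y => Q i y ≠ Q j y)).filter (fun y => y i = c))
    (Finset.univ.filter (fun d => incs Q i c j d)) (fun y => y j) (k ^ (m - 2)) ?_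
  · refine le_trans ?_ h2
    have : k ^ (m - 1) = k * k ^ (m - 2) := by
      rw [← pow_succ']; congr 1; omega
    rw [this]
    exact Nat.mul_le_mul_right _ hc'
  · intro d hd
    obtain ⟨y, hy1, hy2, hy3⟩ := (Finset.mem_filter.1 hd).2
    have h3 := rs_flat hev hn (fun y => Q i y - Q j y) (Finset.univ \ {i, j}) y ?_ (sub_ne_zero.2 hy3)
    · have hcard : (Finset.univ \ {i, j} : Finset (Fin m)).card = m - 2 := by
        rw [Finset.card_sdiff_of_subset (Finset.subset_univ _), Finset.card_pair hij, Finset.card_fin]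
      rw [hcard] at h3
      refine h3.trans (Finset.card_le_card ?_)
      intro y'
      simp only [Finset.mem_filter, Finset.mem_univ, true_and, Finset.mem_sdiff, Finset.mem_insert,
        Finset.mem_singleton, not_not]
      rintro ⟨h4, h5⟩
      refine ⟨⟨fun h => h5 (sub_eq_zero.2 h), ?_⟩, ?_⟩
      · rw [h4 i (Or.inl rfl), hy1]
      · rw [h4 j (Or.inr rfl), hy2]
    · intro l hl
      simp only [Finset.mem_sdiff, Finset.mem_univ, true_and, Finset.mem_insert,
        Finset.mem_singleton, not_or] at hl
      intro y
      exact rs_sub (hQ i l hl.1 y) (hQ j l hl.2 y)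

lemma exists_third (hm : 3 ≤ m) (i j : Fin m) : ∃ l, l ≠ i ∧ l ≠ j := by
  have : ({i, j} : Finset (Fin m)) ≠ Finset.univ := by
    intro h
    have h1 : ({i, j} : Finset (Fin m)).card ≤ 2 := Finset.card_le_two
    rw [h, Finset.card_fin] at h1
    omega
  by_contra hc
  push Not at hc
  apply this
  ext l
  simp only [Finset.mem_insert, Finset.mem_singleton, Finset.mem_univ, iff_true]
  by_cases h : l = i
  · exact Or.inl h
  · exact Or.inr (hc l h)

lemma rs_lemB (hev : Function.Injective ev) (hn : n = 3 * k) (hm : 3 ≤ m) 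
    (Q : Fin m → (Fin m → Fin n) → F) (hQ : ∀ i j, j ≠ i → onAx (RS k ev) j (Q i)) :
    ∃ z : (Fin m → Fin n) → F, (∀ i, onAx (RS k ev) i z) ∧
      ∀ i, hd (Q i) z ≤ 3 ^ m * ∑ i, ∑ j, hd (Q i) (Q j) := by
  let B : Fin m → Finset (Fin n) := fun i => (Finset.univ.erase i).biUnion (fun j => badp k Q i j)
  have hB : ∀ i, (B i).card * k ^ (m - 1) ≤ ∑ i, ∑ j, hd (Q i) (Q j) := by
    intro i
    have h1 : (B i).card ≤ ∑ j ∈ Finset.univ.erase i, (badp k Q i j).card := Finset.card_biUnion_le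
    calc (B i).card * k ^ (m - 1) ≤ (∑ j ∈ Finset.univ.erase i, (badp k Q i j).card) * k ^ (m - 1) :=
          Nat.mul_le_mul_right _ h1
      _ = ∑ j ∈ Finset.univ.erase i, (badp k Q i j).card * k ^ (m - 1) := Finset.sum_mul _ _ _
      _ ≤ ∑ j ∈ Finset.univ.erase i, hd (Q i) (Q j) := Finset.sum_le_sum (fun j hj =>
          badp_card hev hn Q hQ i j (Ne.symm (Finset.ne_of_mem_erase hj)) (by omega))
      _ ≤ ∑ j, hd (Q i) (Q j) := Finset.sum_le_sum_of_subset (Finset.erase_subset _ _)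
      _ ≤ _ := Finset.single_le_sum (f := fun i => ∑ j, hd (Q i) (Q j)) (fun _ _ => Nat.zero_le _)
          (Finset.mem_univ i)
  by_cases hall : ∀ i, k ≤ (B i)ᶜ.card
  · obtain ⟨z, hz, hz'⟩ := rs_glue hev ⟨0, by omega⟩ ⟨1, by omega⟩ (by simp) Q hQ
      (fun i => (B i)ᶜ) hall (by
        intro i j hij y hi hj
        obtain ⟨l, hli, hlj⟩ := exists_third hm i j
        have key : ∀ i, l ≠ i → ∀ c, c ∈ (B i)ᶜ →
            (Finset.univ.filter (fun e => incs Q i c l e)).card < k := by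
          intro i hli c hc
          rw [Finset.mem_compl] at hc
          by_contra hcon
          apply hc
          exact Finset.mem_biUnion.2 ⟨l, Finset.mem_erase.2 ⟨hli, Finset.mem_univ _⟩,
            Finset.mem_filter.2 ⟨Finset.mem_univ _, by omega⟩⟩
        have k1 := key i hli _ hi
        have k2 := key j hlj _ hj
        have k3 := Finset.card_union_le (Finset.univ.filter (fun e => incs Q i (y i) l e))
          (Finset.univ.filter (fun e => incs Q j (y j) l e))
        have k4 := Finset.card_add_card_compl (Finset.univ.filter (fun e => incs Q i (y i) l e) ∪
          (Finset.univ.filter (fun e => incs Q j (y j) l e)))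
        rw [Fintype.card_fin] at k4
        have := rs_eq hev (hQ i l hli y) (hQ j l hlj y)
          (Finset.univ.filter (fun e => incs Q i (y i) l e) ∪
          (Finset.univ.filter (fun e => incs Q j (y j) l e)))ᶜ (by omega) (by
          intro s hs
          rw [Finset.mem_compl, Finset.mem_union, not_or] at hs
          simp only [Finset.mem_filter, Finset.mem_univ, true_and] at hs
          have e1 : Q i (Function.update y l s) = Q l (Function.update y l s) := by
            by_contra hne
            exact hs.1 ⟨_, by rw [Function.update_of_ne (Ne.symm hli)], by rw [Function.update_self], hne⟩
          have e2 : Q j (Function.update y l s) = Q l (Function.update y l s) := by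
            by_contra hne
            exact hs.2 ⟨_, by rw [Function.update_of_ne (Ne.symm hlj)], by rw [Function.update_self], hne⟩
          rw [e1, e2])
        have := congrFun this (y l)
        simpa only [Function.update_eq_self] using this)
    refine ⟨z, hz, fun i => ?_⟩
    have h1 := hd_slab (Q i) z i (B i) (by
      intro y hy
      by_contra hc
      exact hy (hz' i y (Finset.mem_compl.2 hc)))
    refine h1.trans ?_
    have hn' : n ^ (m - 1) = 3 ^ (m - 1) * k ^ (m - 1) := by rw [hn, mul_pow]
    rw [hn']
    calc (B i).card * (3 ^ (m - 1) * k ^ (m - 1)) = 3 ^ (m - 1) * ((B i).card * k ^ (m - 1)) := by ring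
      _ ≤ 3 ^ m * ∑ i, ∑ j, hd (Q i) (Q j) :=
        Nat.mul_le_mul (Nat.pow_le_pow_right (by norm_num) (by omega)) (hB i)
  · push Not at hall
    obtain ⟨i₀, hi₀⟩ := hall
    refine ⟨0, fun i y => rs_zero, fun i => ?_⟩
    have k4 := Finset.card_add_card_compl (B i₀)
    rw [Fintype.card_fin] at k4
    refine (hd_le_card _ _).trans ?_
    rw [Fintype.card_fun, Fintype.card_fin, Fintype.card_fin, show n ^ m = 3 ^ m * k ^ m by rw [hn, mul_pow]]
    apply Nat.mul_le_mul_left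
    refine le_trans ?_ (hB i₀)
    have : k ^ m = k * k ^ (m - 1) := by rw [← pow_succ']; congr 1; omega
    rw [this]
    exact Nat.mul_le_mul_right _ (by omega)

end RSgrid

section RSgrid
open scoped Classical

variable {F : Type*} [Field F] {n k m : ℕ} {ev : Fin n → F}

lemma rs_base (hev : Function.Injective ev) (hn : n = 3 * k) (hk : 1 ≤ k)
    (f : Fin 2 → (Fin 2 → Fin n) → F) (hf : ∀ i, onAx (RS k ev) i (f i)) :
    ∃ z : (Fin 2 → Fin n) → F, (∀ i, onAx (RS k ev) i z) ∧
      ∀ i, hd (f i) z ≤ 36 * hd (f 0) (f 1) := by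
  by_cases hN : (k / 2 + 1) ^ 2 ≤ hd (f 0) (f 1)
  · refine ⟨0, fun i y => rs_zero, fun i => ?_⟩
    refine (hd_le_card _ _).trans ?_
    rw [Fintype.card_fun, Fintype.card_fin, Fintype.card_fin]
    have h1 : k ≤ 2 * (k / 2 + 1) := by omega
    have h2 : n ^ 2 = 9 * k ^ 2 := by rw [hn]; ring
    have h3 : k ^ 2 ≤ (2 * (k / 2 + 1)) ^ 2 := Nat.pow_le_pow_left h1 2
    rw [mul_pow] at h3
    omega
  · push Not at hN
    choose p hp hp' using fun j : Fin n => hf 0 (![j, j] : Fin 2 → Fin n)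
    choose q hq hq' using fun j : Fin n => hf 1 (![j, j] : Fin 2 → Fin n)
    have u0 : ∀ j s : Fin n, Function.update (![j, j] : Fin 2 → Fin n) 0 s = ![s, j] := by
      intro j s; funext l; fin_cases l <;> rfl
    have u1 : ∀ j s : Fin n, Function.update (![j, j] : Fin 2 → Fin n) 1 s = ![j, s] := by
      intro j s; funext l; fin_cases l <;> rfl
    simp only [u0] at hp'
    simp only [u1] at hq'
    have hy : ∀ y : Fin 2 → Fin n, y = ![y 0, y 1] := by
      intro y; funext l; fin_cases l <;> rfl
    obtain ⟨GX, GY, hGX, hGY, hG⟩ := ps_core (a := k / 2) ev hev p q hp hq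
      (Finset.univ.filter (fun x : Fin n × Fin n => f 0 ![x.1, x.2] ≠ f 1 ![x.1, x.2]))
      (by
        intro i j hij
        simp only [Finset.mem_filter, Finset.mem_univ, true_and, not_not] at hij
        rw [← hp' j i, ← hq' i j, hij])
      (by
        refine lt_of_le_of_lt ?_ hN
        apply Finset.card_le_card_of_injOn (fun x : Fin n × Fin n => ![x.1, x.2])
        · intro x hx
          simpa using hx
        · rintro ⟨a, b⟩ _ ⟨c, d⟩ _ h
          have h0 := congrFun h 0
          have h1 := congrFun h 1
          simp at h0 h1
          rw [h0, h1])
      hk (by omega)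
    have hrev : ∀ i j : Fin 2, j ≠ i → i.rev = j := by decide
    have hcc : ∀ i, k ≤ ((![GX, GY] : Fin 2 → Finset (Fin n)) i).card := by
      intro i; fin_cases i
      · show k ≤ GX.card
        omega
      · show k ≤ GY.card
        omega
    have hcc' : ∀ i, n ≤ ((![GX, GY] : Fin 2 → Finset (Fin n)) i).card + k / 2 := by
      intro i; fin_cases i
      · exact hGX
      · exact hGY
    have h01 : ∀ y : Fin 2 → Fin n, y 0 ∈ GX → y 1 ∈ GY → f 0 y = f 1 y := by
      intro y h0 h1
      rw [hy y, hp', hq', hG _ h0 _ h1]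
    obtain ⟨z, hz, hz'⟩ := rs_glue hev (0 : Fin 2) 1 (by decide) (fun i => f i.rev)
      (by intro i j hj; rw [hrev i j hj]; exact hf j) ![GX, GY] hcc
      (by
        intro i j hij y hi hj
        rw [hrev i j (Ne.symm hij), hrev j i hij]
        fin_cases i <;> fin_cases j
        · exact absurd rfl hij
        · exact (h01 y hi hj).symm
        · exact h01 y hj hi
        · exact absurd rfl hij)
    refine ⟨z, hz, ?_⟩
    have main : ∀ i j : Fin 2, j ≠ i → hd (f j) z ≤ 3 * hd (f j) (f i) := by
      intro i j hij
      have hzi : ∀ y, y i ∈ (![GX, GY] : Fin 2 → Finset (Fin n)) i → f j y = z y := by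
        intro y hy; rw [← hz' i y hy, hrev i j hij]
      have hzj : ∀ y, y j ∈ (![GX, GY] : Fin 2 → Finset (Fin n)) j → f i y = z y := by
        intro y hy; rw [← hz' j y hy, hrev j i (Ne.symm hij)]
      let B := Finset.univ.filter (fun c : Fin n => ∃ y, y i = c ∧ f j y ≠ z y)
      have h1 := hd_slab (f j) z i B (fun y hy => Finset.mem_filter.2 ⟨Finset.mem_univ _, y, rfl, hy⟩)
      have h2 : B.card * k ≤ hd (f j) (f i) := by
        apply fiber_le _ _ (fun y => y i)
        intro c hc
        obtain ⟨y, hyc, hyne⟩ := (Finset.mem_filter.1 hc).2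
        have hw := rs_wt hev hn (rs_sub (hf j y) (hz j y)) (by
          intro h
          have := congrFun h (y j)
          simp only [Function.update_eq_self] at this
          exact hyne (sub_eq_zero.1 this))
        have hw2 : k ≤ ((Finset.univ.filter (fun s => f j (Function.update y j s) -
            z (Function.update y j s) ≠ 0)) ∩ (![GX, GY] : Fin 2 → Finset (Fin n)) j).card := by
          have e1 := Finset.card_union_add_card_inter (Finset.univ.filter (fun s =>
            f j (Function.update y j s) - z (Function.update y j s) ≠ 0))
            ((![GX, GY] : Fin 2 → Finset (Fin n)) j)
          have e2 := Finset.card_le_univ ((Finset.univ.filter (fun s =>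
            f j (Function.update y j s) - z (Function.update y j s) ≠ 0)) ∪
            ((![GX, GY] : Fin 2 → Finset (Fin n)) j))
          rw [Fintype.card_fin] at e2
          have e3 := hcc' j
          omega
        refine hw2.trans ?_
        apply Finset.card_le_card_of_injOn (fun s => Function.update y j s)
        · intro s hs
          have hs' := Finset.mem_inter.1 hs
          have hs1 := (Finset.mem_filter.1 hs'.1).2
          have := hzj (Function.update y j s) (by rw [Function.update_self]; exact hs'.2)
          simp only [Finset.coe_filter, Set.mem_setOf_eq, Finset.mem_filter, Finset.mem_univ, true_and]
          refine ⟨?_, ?_⟩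
          · rw [this]
            exact fun h => hs1 (sub_eq_zero.2 h)
          · rw [Function.update_of_ne (Ne.symm hij), hyc]
        · intro s _ s' _ h
          exact Function.update_injective y j h
      have h3 : B.card * n ^ (2 - 1) = 3 * (B.card * k) := by
        have : n ^ (2 - 1) = 3 * k := by rw [hn]; ring
        rw [this]; ring
      omega
    intro i
    fin_cases i
    · have := main 1 0 (by decide)
      show hd (f 0) z ≤ _
      omega
    · have := main 0 1 (by decide)
      rw [hd_comm (f 1) (f 0)] at this
      show hd (f 1) z ≤ _
      omega

end RSgrid

section RSgrid
open scoped Classical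

lemma hd_slice {F : Type*} {m n : ℕ} (i : Fin (m + 1)) (u v : (Fin (m + 1) → Fin n) → F) :
    hd u v = ∑ c : Fin n, hd (fun y : Fin m → Fin n => u (Fin.insertNth (α := fun _ => Fin n) i c y))
      (fun y => v (Fin.insertNth (α := fun _ => Fin n) i c y)) := by
  unfold hd
  simp only [Finset.card_filter]
  rw [← Equiv.sum_comp (Fin.insertNthEquiv (fun _ => Fin n) i), Fintype.sum_prod_type]
  rfl

theorem rs_agree (m : ℕ) (hm : 2 ≤ m) : ∃ K : ℕ, ∀ (F : Type) [Field F] (n k : ℕ) (ev : Fin n → F),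
    Function.Injective ev → n = 3 * k → 1 ≤ k → ∀ f : Fin m → (Fin m → Fin n) → F,
    (∀ i, onAx (RS k ev) i (f i)) → ∃ z : (Fin m → Fin n) → F, (∀ i, onAx (RS k ev) i z) ∧
      ∀ i, hd (f i) z ≤ K * ∑ i, ∑ j, hd (f i) (f j) := by
  induction m, hm using Nat.le_induction with
  | base =>
    refine ⟨36, fun F _ n k ev hev hn hk f hf => ?_⟩
    obtain ⟨z, hz, hz'⟩ := rs_base hev hn hk f hf
    refine ⟨z, hz, fun i => (hz' i).trans ?_⟩
    apply Nat.mul_le_mul_left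
    simp only [Fin.sum_univ_two]
    omega
  | succ m hm ih =>
    obtain ⟨K, hK⟩ := ih
    refine ⟨K + 3 ^ (m + 1) * ((m + 1) * ((m + 1) * (2 * K))), fun F _ n k ev hev hn hk f hf => ?_⟩
    let g : Fin (m + 1) → Fin n → Fin m → (Fin m → Fin n) → F := fun i c j' y =>
      f (i.succAbove j') (Fin.insertNth (α := fun _ => Fin n) i c y)
    have hg : ∀ i c j', onAx (RS k ev) j' (g i c j') := by
      intro i c j' y
      have := hf (i.succAbove j') (Fin.insertNth (α := fun _ => Fin n) i c y)
      simp only [g]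
      convert this using 3 with s
      rw [Fin.insertNth_update]
    choose zz hzz hzz' using fun i c => hK F n k ev hev hn hk (g i c) (hg i c)
    let Q : Fin (m + 1) → (Fin (m + 1) → Fin n) → F := fun i y => zz i (y i) (i.removeNth y)
    set S := ∑ i, ∑ j, hd (f i) (f j) with hS
    have hQ : ∀ i j, j ≠ i → onAx (RS k ev) j (Q i) := by
      intro i j hj y
      obtain ⟨j', rfl⟩ := Fin.exists_succAbove_eq hj
      have := hzz i (y i) j' (i.removeNth y)
      simp only [Q]
      convert this using 3 with s
      · rw [Function.update_of_ne (Ne.symm hj)]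
      · rw [Fin.removeNth_update_succAbove]
    have hQf : ∀ i j, j ≠ i → hd (Q i) (f j) ≤ K * S := by
      intro i j hj
      obtain ⟨j', rfl⟩ := Fin.exists_succAbove_eq hj
      rw [hd_slice i]
      have h1 : ∀ c, hd (fun y : Fin m → Fin n => Q i (Fin.insertNth (α := fun _ => Fin n) i c y))
          (fun y => f (i.succAbove j') (Fin.insertNth (α := fun _ => Fin n) i c y)) ≤
          K * ∑ a, ∑ b, hd (g i c a) (g i c b) := by
        intro c
        have : (fun y : Fin m → Fin n => Q i (Fin.insertNth (α := fun _ => Fin n) i c y)) = zz i c := by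
          funext y
          simp [Q]
        rw [this, hd_comm]
        exact hzz' i c j'
      refine (Finset.sum_le_sum (fun c _ => h1 c)).trans ?_
      rw [← Finset.mul_sum]
      apply Nat.mul_le_mul_left
      rw [Finset.sum_comm]
      have h2 : ∀ a, ∑ c, ∑ b, hd (g i c a) (g i c b) =
          ∑ b, hd (f (i.succAbove a)) (f (i.succAbove b)) := by
        intro a
        rw [Finset.sum_comm]
        apply Finset.sum_congr rfl
        intro b _
        rw [hd_slice i]
      simp only [h2]
      rw [hS, Fin.sum_univ_succAbove _ i]
      refine le_trans ?_ (Nat.le_add_left _ _)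
      apply Finset.sum_le_sum
      intro a _
      rw [Fin.sum_univ_succAbove _ i]
      exact Nat.le_add_left _ _
    have hQQ : ∀ i j, hd (Q i) (Q j) ≤ 2 * K * S := by
      intro i j
      obtain ⟨l, hl1, hl2⟩ := exists_third (by omega) i j
      have h1 := hQf i l hl1
      have h2 := hQf j l hl2
      have h3 := hd_tri (Q i) (f l) (Q j)
      rw [hd_comm (f l)] at h3
      calc _ ≤ _ := h3
        _ ≤ K * S + K * S := Nat.add_le_add h1 h2
        _ = _ := by ring
    obtain ⟨z, hz, hz'⟩ := rs_lemB hev hn (by omega) Q hQ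
    refine ⟨z, hz, fun i => ?_⟩
    obtain ⟨l, hl, _⟩ := exists_third (by omega) i i
    have h1 := hQf l i (Ne.symm hl)
    have h2 := hd_tri (f i) (Q l) z
    rw [hd_comm (f i) (Q l)] at h2
    have h3 : ∑ i, ∑ j, hd (Q i) (Q j) ≤ (m + 1) * ((m + 1) * (2 * K * S)) := by
      calc ∑ i, ∑ j, hd (Q i) (Q j) ≤ ∑ i : Fin (m + 1), ∑ j : Fin (m + 1), 2 * K * S :=
            Finset.sum_le_sum (fun i _ => Finset.sum_le_sum (fun j _ => hQQ i j))
        _ = _ := by simp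
    have h4 := (hz' l).trans (Nat.mul_le_mul_left _ h3)
    calc _ ≤ _ := h2
      _ ≤ _ := Nat.add_le_add h1 h4
      _ = _ := by ring

end RSgrid

section RSident
variable {F : Type*} [Field F] {n k : ℕ} {w : F}

lemma w_orth (hw : IsPrimitiveRoot w n) (a b : Fin n) :
    ∑ s : Fin n, (w ^ (a : ℕ) * (w⁻¹) ^ (b : ℕ)) ^ (s : ℕ) = if a = b then (n : F) else 0 := by
  have hn : n ≠ 0 := by have := a.2; omega
  have hw0 : w ≠ 0 := hw.ne_zero hn
  rw [Fin.sum_univ_eq_sum_range (fun s => (w ^ (a : ℕ) * (w⁻¹) ^ (b : ℕ)) ^ s) n]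
  split_ifs with h
  · subst h
    rw [← mul_pow, mul_inv_cancel₀ hw0, one_pow]
    simp
  · have hr : w ^ (a : ℕ) * (w⁻¹) ^ (b : ℕ) ≠ 1 := by
      intro h1
      apply h
      apply Fin.ext
      apply hw.pow_inj a.2 b.2
      rw [inv_pow] at h1
      exact (mul_inv_eq_one₀ (pow_ne_zero _ hw0)).1 h1
    rw [geom_sum_eq hr]
    have : (w ^ (a : ℕ) * (w⁻¹) ^ (b : ℕ)) ^ n = 1 := by
      rw [mul_pow, ← pow_mul, ← pow_mul, mul_comm (a : ℕ), mul_comm (b : ℕ), pow_mul, pow_mul, inv_pow,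
        hw.pow_eq_one]
      simp
    rw [this, sub_self, zero_div]

lemma wordPoly_eval (c : Fin n → F) (x : F) : (wordPoly c).eval x = ∑ s, c s * x ^ (s : ℕ) := by
  unfold wordPoly
  rw [eval_finsetSum]
  simp

lemma cyclic_iff (hw : IsPrimitiveRoot w n) (hk : k ≤ n) (hn : 0 < n) (c : Fin n → F) :
    c ∈ cyclicCode n (rsCheck k w) ↔ ∀ i : Fin n, k ≤ (i : ℕ) → (wordPoly c).eval (w ^ (i : ℕ)) = 0 := by
  have hck : ∀ x, (rsCheck k w).eval x = ∏ i ∈ Finset.range k, (x - w ^ i) := by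
    intro x
    simp [rsCheck, eval_prod]
  constructor
  · rintro ⟨r, hr⟩ i hi
    have h1 := congrArg (eval (w ^ (i : ℕ))) hr
    rw [eval_mul, eval_mul, hck] at h1
    have h2 : eval (w ^ (i : ℕ)) (X ^ n - 1 : F[X]) = 0 := by
      simp only [eval_sub, eval_pow, eval_X, eval_one]
      rw [← pow_mul, mul_comm, pow_mul, hw.pow_eq_one, one_pow, sub_self]
    rw [h2, zero_mul] at h1
    rcases mul_eq_zero.1 h1 with h3 | h3
    · exfalso
      obtain ⟨j, hj, hj'⟩ := Finset.prod_eq_zero_iff.1 h3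
      have hj := Finset.mem_range.1 hj
      have := hw.pow_inj i.2 (by omega) (sub_eq_zero.1 hj')
      omega
    · exact h3
  · intro h
    show (X ^ n - 1 : F[X]) ∣ _
    have hmon : (X ^ n - 1 : F[X]).Monic := by
      have := monic_X_pow_sub_C (1 : F) hn.ne'
      simpa using this
    rw [← modByMonic_eq_zero_iff_dvd hmon]
    have hinj : Function.Injective (fun i : Fin n => w ^ (i : ℕ)) := fun a b hab =>
      Fin.ext (hw.pow_inj a.2 b.2 hab)
    apply eq_zero_of_degree_lt_of_eval_index_eq_zero (s := (Finset.univ : Finset (Fin n)))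
      (v := fun i : Fin n => w ^ (i : ℕ)) hinj.injOn
    · have h1 := degree_modByMonic_lt (rsCheck k w * wordPoly c) hmon
      have h2 : (X ^ n - 1 : F[X]).degree = n := by
        have := degree_X_pow_sub_C hn (1 : F)
        simpa using this
      rw [h2] at h1
      simpa using h1
    · intro i _
      have h1 := modByMonic_add_div (rsCheck k w * wordPoly c) (X ^ n - 1 : F[X])
      have h1 := congrArg (eval (w ^ (i : ℕ))) h1
      have h2 : eval (w ^ (i : ℕ)) (X ^ n - 1 : F[X]) = 0 := by
        simp only [eval_sub, eval_pow, eval_X, eval_one]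
        rw [← pow_mul, mul_comm, pow_mul, hw.pow_eq_one, one_pow, sub_self]
      rw [eval_add, eval_mul, h2, zero_mul, add_zero] at h1
      rw [h1, eval_mul, hck]
      by_cases hi : k ≤ i
      · rw [h i hi, mul_zero]
      · rw [Finset.prod_eq_zero (Finset.mem_range.2 (by omega : (i : ℕ) < k)) (sub_self _), zero_mul]

lemma cyclic_eq_RS (hw : IsPrimitiveRoot w n) (hk : k ≤ n) (hk1 : 1 ≤ k) (hnF : (n : F) ≠ 0) :
    cyclicCode n (rsCheck k w) = RS k (fun s : Fin n => (w⁻¹) ^ (s : ℕ)) := by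
  ext c
  rw [cyclic_iff hw hk (by omega)]
  constructor
  · intro h
    refine ⟨∑ j : Fin n, if (j : ℕ) < k then
      C ((n : F)⁻¹ * (wordPoly c).eval (w ^ (j : ℕ))) * X ^ (j : ℕ) else 0, ?_, ?_⟩
    · rw [← mem_degreeLT]
      apply Submodule.sum_mem
      intro j _
      split_ifs with hj
      · rw [mem_degreeLT]
        exact lt_of_le_of_lt (degree_C_mul_X_pow_le _ _) (by exact_mod_cast hj)
      · exact Submodule.zero_mem _
    · intro s
      rw [eval_finsetSum]
      have h1 : ∀ j : Fin n, eval ((w⁻¹) ^ (s : ℕ)) (if (j : ℕ) < k then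
          C ((n : F)⁻¹ * (wordPoly c).eval (w ^ (j : ℕ))) * X ^ (j : ℕ) else 0) =
          ∑ s' : Fin n, (n : F)⁻¹ * c s' * (w ^ (s' : ℕ) * (w⁻¹) ^ (s : ℕ)) ^ (j : ℕ) := by
        intro j
        have h2 : (n : F)⁻¹ * (wordPoly c).eval (w ^ (j : ℕ)) * ((w⁻¹) ^ (s : ℕ)) ^ (j : ℕ) =
            ∑ s' : Fin n, (n : F)⁻¹ * c s' * (w ^ (s' : ℕ) * (w⁻¹) ^ (s : ℕ)) ^ (j : ℕ) := by
          rw [wordPoly_eval, Finset.mul_sum, Finset.sum_mul]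
          apply Finset.sum_congr rfl
          intro s' _
          rw [mul_pow, ← pow_mul w, ← pow_mul w, mul_comm (j : ℕ) (s' : ℕ)]
          ring
        rw [← h2]
        split_ifs with hj
        · simp
        · rw [h j (by omega)]; simp
      simp only [h1]
      rw [Finset.sum_comm]
      simp only [← Finset.mul_sum, w_orth hw]
      simp only [mul_ite, mul_zero, Finset.sum_ite_eq', Finset.mem_univ, if_true]
      field_simp
  · rintro ⟨p, hp, hc⟩ i hi
    rw [wordPoly_eval]
    have hp' : p.natDegree < k := by
      rw [Nat.lt_iff_add_one_le]
      by_cases h0 : p = 0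
      · subst h0; simpa using hk1
      · exact (natDegree_lt_iff_degree_lt h0).2 hp
    have h1 : ∀ s : Fin n, c s * (w ^ (i : ℕ)) ^ (s : ℕ) =
        ∑ j ∈ Finset.range k, p.coeff j * (w ^ (i : ℕ) * (w⁻¹) ^ j) ^ (s : ℕ) := by
      intro s
      rw [hc, eval_eq_sum_range' hp', Finset.sum_mul]
      apply Finset.sum_congr rfl
      intro j _
      rw [mul_pow, ← pow_mul w⁻¹, ← pow_mul w⁻¹, mul_comm (s : ℕ) j]
      ring
    simp only [h1]
    rw [Finset.sum_comm]
    apply Finset.sum_eq_zero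
    intro j hj
    have hj := Finset.mem_range.1 hj
    rw [← Finset.mul_sum]
    have := w_orth hw i ⟨j, by omega⟩
    simp only at this
    rw [this, if_neg, mul_zero]
    intro h
    have := congrArg Fin.val h
    simp at this
    omega

/-- facts about the field -/
lemma field_facts {F : Type} [Field F] [Fintype F] (t : ℕ) (ht : 1 ≤ t)
    (hF : Fintype.card F = 2 ^ (2 * t)) (ω : Fˣ) (hω : ∀ u : Fˣ, u ∈ Subgroup.zpowers ω) :
    IsPrimitiveRoot (ω : F) (2 ^ (2 * t) - 1) ∧ ((2 ^ (2 * t) - 1 : ℕ) : F) ≠ 0 ∧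
      2 ^ (2 * t) - 1 = 3 * ((2 ^ (2 * t) - 1) / 3) ∧ 1 ≤ (2 ^ (2 * t) - 1) / 3 := by
  have h4 : 2 ^ (2 * t) = 4 ^ t := by rw [pow_mul]; norm_num
  have h41 : 4 ^ 1 ≤ 4 ^ t := Nat.pow_le_pow_right (by norm_num) ht
  have hmod : 4 ^ t % 3 = 1 := by
    rw [Nat.pow_mod]; simp
  refine ⟨?_, ?_, by omega, by omega⟩
  · rw [IsPrimitiveRoot.coe_units_iff]
    have h1 : orderOf ω = 2 ^ (2 * t) - 1 := by
      rw [orderOf_eq_card_of_forall_mem_zpowers hω, Nat.card_units, Nat.card_eq_fintype_card, hF]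
    rw [← h1]
    exact IsPrimitiveRoot.orderOf ω
  · rw [Nat.cast_sub (by omega)]
    have : ((2 ^ (2 * t) : ℕ) : F) = 0 := by
      rw [← hF]; exact Nat.cast_card_eq_zero F
    rw [this]
    simp

end RSident

section RSgrid
open scoped Classical

lemma normWt_sub_eq {ι F : Type*} [Fintype ι] [AddGroup F] (x c : ι → F) :
    normWt (x - c) = (hd x c : ℝ) / (Fintype.card ι : ℝ) := by
  unfold normWt hd
  congr 2
  rw [Nat.card_eq_fintype_card, Fintype.card_subtype]
  congr 1
  ext p
  simp [sub_eq_zero]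

lemma distTo_le {ι F : Type*} [Fintype ι] [AddGroup F] (x : ι → F) (S : Set (ι → F)) {c : ι → F}
    (hc : c ∈ S) : distTo x S ≤ (hd x c : ℝ) / (Fintype.card ι : ℝ) := by
  rw [← normWt_sub_eq]
  apply csInf_le
  · refine ⟨0, ?_⟩
    rintro _ ⟨c, _, rfl⟩
    simp only [normWt_sub_eq]
    positivity
  · exact ⟨c, hc, rfl⟩

lemma distTo_attained {ι F : Type*} [Fintype ι] [AddGroup F] [Finite F] (x : ι → F)
    (S : Set (ι → F)) (hS : S.Nonempty) :
    ∃ c ∈ S, distTo x S = (hd x c : ℝ) / (Fintype.card ι : ℝ) := by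
  have h := Set.Nonempty.csInf_mem (hS.image (fun c => normWt (x - c))) (S.toFinite.image _)
  obtain ⟨c, hc, h⟩ := h
  exact ⟨c, hc, by rw [← normWt_sub_eq]; exact h.symm⟩

lemma sum_update {m n : ℕ} (i : Fin m) (φ : (Fin m → Fin n) → ℕ) :
    ∑ y : Fin m → Fin n, ∑ s : Fin n, φ (Function.update y i s) = n * ∑ y, φ y := by
  have hinv : Function.Involutive (fun p : (Fin m → Fin n) × Fin n => (Function.update p.1 i p.2, p.1 i)) := by
    rintro ⟨y, s⟩
    simp
  rw [← Fintype.sum_prod_type' (fun y s => φ (Function.update y i s))]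
  rw [← Equiv.sum_comp hinv.toPerm]
  simp only [Function.Involutive.coe_toPerm, Function.update_idem, Function.update_eq_self]
  rw [Fintype.sum_prod_type]
  simp [Finset.mul_sum]

lemma hd_lines {F : Type*} {m n : ℕ} (i : Fin m) (u v : (Fin m → Fin n) → F) :
    ∑ y : Fin m → Fin n, hd (fun s => u (Function.update y i s)) (fun s => v (Function.update y i s)) =
      n * hd u v := by
  unfold hd
  simp only [Finset.card_filter]
  exact sum_update i (fun y => if u y ≠ v y then 1 else 0)

variable {F : Type} [Field F] {n k m : ℕ} {ev : Fin n → F}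

lemma mem_prod_iff (z : (Fin m → Fin n) → F) :
    z ∈ prodCode (n := fun _ : Fin m => n) (fun _ => RS k ev) ↔ ∀ i, onAx (RS k ev) i z :=
  Set.mem_iInter

/-- the agreement property with constant `K` -/
def AgreeK (m K k : ℕ) (ev : Fin n → F) : Prop :=
  ∀ f : Fin m → (Fin m → Fin n) → F,
    (∀ i, onAx (RS k ev) i (f i)) → ∃ z : (Fin m → Fin n) → F, (∀ i, onAx (RS k ev) i z) ∧
      ∀ i, hd (f i) z ≤ K * ∑ i, ∑ j, hd (f i) (f j)

lemma linewise [Finite F] (hn0 : 0 < n) (x : (Fin m → Fin n) → F) :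
    ∃ f : Fin m → (Fin m → Fin n) → F, (∀ i, onAx (RS k ev) i (f i)) ∧
      lineTestE (n := fun _ : Fin m => n) (fun _ => RS k ev) x =
        ((∑ i, (hd x (f i) : ℝ)) / (Fintype.card (Fin m → Fin n) : ℝ)) / m := by
  choose near hnear hnear' using fun c : Fin n → F => distTo_attained c (RS k ev) ⟨0, rs_zero⟩
  refine ⟨fun i y => near (fun s => x (Function.update y i s)) (y i), ?_, ?_⟩
  · intro i y
    simp only [Function.update_idem, Function.update_self]
    exact hnear _
  · unfold lineTestE
    congr 1
    rw [Finset.sum_div]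
    apply Finset.sum_congr rfl
    intro i _
    congr 1
    have h1 := hd_lines i x (fun y => near (fun s => x (Function.update y i s)) (y i))
    simp only [Function.update_idem, Function.update_self] at h1
    have h2 : ∀ y : Fin m → Fin n, distTo (lineRestrict (n := fun _ : Fin m => n) x i y) (RS k ev) =
        (hd (fun s => x (Function.update y i s)) (near (fun s => x (Function.update y i s))) : ℝ) /
          (n : ℝ) := by
      intro y
      have := hnear' (fun s => x (Function.update y i s))
      rw [Fintype.card_fin] at this
      exact this
    have h3 : (∑ y : Fin m → Fin n, distTo (lineRestrict (n := fun _ : Fin m => n) x i y) (RS k ev)) =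
        (hd x (fun y => near (fun s => x (Function.update y i s)) (y i)) : ℝ) := by
      simp only [h2]
      rw [← Finset.sum_div, ← Nat.cast_sum, h1]
      push_cast
      field_simp
    exact h3

lemma hd_zero {ι F : Type*} [Fintype ι] {x c : ι → F} (h : hd x c = 0) : x = c := by
  unfold hd at h
  rw [Finset.card_eq_zero] at h
  funext y
  by_contra hne
  have : y ∈ (Finset.univ.filter (fun y => x y ≠ c y)) := by simpa using hne
  rw [h] at this
  simp at this

lemma part_two [Finite F] (hev : Function.Injective ev) (hn : n = 3 * k) (hk : 1 ≤ k) (hm : 2 ≤ m)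
    (K : ℕ) (hK : AgreeK m K k ev) :
    1 / ((m : ℝ) * (1 + 2 * m * K)) ≤
      lineRobustConst (n := fun _ : Fin m => n) (fun _ => RS k ev) := by
  have hn0 : 0 < n := by omega
  haveI : Nonempty (Fin n) := ⟨⟨0, hn0⟩⟩
  have hN : (0 : ℝ) < (Fintype.card (Fin m → Fin n) : ℝ) := by exact_mod_cast Fintype.card_pos
  have hm0 : (0 : ℝ) < m := by exact_mod_cast (by omega : 0 < m)
  apply le_csSup
  · -- bounded above
    let y0 : Fin m → Fin n := fun _ => ⟨0, hn0⟩
    let x : (Fin m → Fin n) → F := Pi.single y0 1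
    have hx : 0 < distTo x (prodCode (n := fun _ : Fin m => n) (fun _ => RS k ev)) := by
      obtain ⟨c, hc, h⟩ := distTo_attained x (prodCode (n := fun _ : Fin m => n) (fun _ => RS k ev))
        ⟨0, (mem_prod_iff _).2 (fun i y => rs_zero)⟩
      rw [h]
      apply div_pos _ hN
      rw [Nat.cast_pos]
      apply Nat.pos_of_ne_zero
      intro h0
      have hxc := hd_zero h0
      rw [← hxc] at hc
      have h1 := (mem_prod_iff _).1 hc ⟨0, by omega⟩ y0
      have h2 := rs_wt hev hn h1 (by
        intro h
        have := congrFun h (y0 ⟨0, by omega⟩)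
        simp only [Function.update_eq_self] at this
        simp [x] at this)
      have h3 : (Finset.univ.filter (fun s => x (Function.update y0 ⟨0, by omega⟩ s) ≠ 0)) ⊆
          {y0 ⟨0, by omega⟩} := by
        intro s hs
        have hs := (Finset.mem_filter.1 hs).2
        rw [Finset.mem_singleton]
        by_contra hne
        apply hs
        simp only [x]
        apply Pi.single_eq_of_ne
        intro h
        have := congrFun h ⟨0, by omega⟩
        rw [Function.update_self] at this
        exact hne this
      have h4 := Finset.card_le_card h3
      rw [Finset.card_singleton] at h4
      omega
    refine ⟨lineTestE (n := fun _ : Fin m => n) (fun _ => RS k ev) x /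
      distTo x (prodCode (n := fun _ : Fin m => n) (fun _ => RS k ev)), ?_⟩
    intro α hα
    rw [le_div_iff₀ hx]
    exact hα x
  · intro x
    obtain ⟨f, hf, hE⟩ := linewise (k := k) (ev := ev) hn0 x
    rw [hE]
    obtain ⟨z, hz, hz'⟩ := hK f hf
    have hd1 := distTo_le x _ ((mem_prod_iff z).2 hz)
    set S := ∑ i, hd x (f i) with hS
    have h1 : ∑ i, ∑ j, hd (f i) (f j) ≤ 2 * m * S := by
      calc ∑ i, ∑ j, hd (f i) (f j) ≤ ∑ i, ∑ j, (hd x (f i) + hd x (f j)) := by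
            apply Finset.sum_le_sum; intro i _
            apply Finset.sum_le_sum; intro j _
            have := hd_tri (f i) x (f j)
            rwa [hd_comm (f i) x] at this
        _ = 2 * m * S := by
            simp only [Finset.sum_add_distrib, Finset.sum_const, Finset.card_fin, smul_eq_mul,
              ← Finset.mul_sum, ← hS]
            ring
    have h2 : hd x z ≤ (1 + 2 * m * K) * S := by
      have i0 : Fin m := ⟨0, by omega⟩
      have e1 := hd_tri x (f i0) z
      have e2 : hd x (f i0) ≤ S := Finset.single_le_sum (f := fun i => hd x (f i))
        (fun _ _ => Nat.zero_le _) (Finset.mem_univ i0)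
      have e3 := (hz' i0).trans (Nat.mul_le_mul_left K h1)
      calc hd x z ≤ S + K * (2 * m * S) := by omega
        _ = _ := by ring
    have h3 : (hd x z : ℝ) ≤ (1 + 2 * m * K) * S := by exact_mod_cast h2
    have h4 : (∑ i, (hd x (f i) : ℝ)) = (S : ℝ) := by rw [hS]; push_cast; rfl
    rw [h4]
    have hA : (0 : ℝ) < 1 + 2 * m * K := by positivity
    have h5 : distTo x (prodCode (n := fun _ : Fin m => n) (fun _ => RS k ev)) ≤
        (1 + 2 * m * K) * S / (Fintype.card (Fin m → Fin n) : ℝ) :=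
      hd1.trans (div_le_div_of_nonneg_right h3 hN.le)
    calc _ ≤ 1 / ((m : ℝ) * (1 + 2 * m * K)) *
          ((1 + 2 * m * K) * S / (Fintype.card (Fin m → Fin n) : ℝ)) :=
        mul_le_mul_of_nonneg_left h5 (by positivity)
      _ = _ := by field_simp

lemma lineWt_eq (u z : (Fin m → Fin n) → F) (i : Fin m) :
    lineWt (n := fun _ : Fin m => n) (u - z) i =
      ((Finset.univ.filter (fun y : Fin m → Fin n =>
        (fun s => u (Function.update y i s) - z (Function.update y i s)) ≠ 0)).card : ℝ) /
        (Fintype.card (Fin m → Fin n) : ℝ) := by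
  unfold lineWt
  congr 2
  rw [Nat.card_eq_fintype_card, Fintype.card_subtype]
  rfl

lemma lineWt_le (hev : Function.Injective ev) (hn : n = 3 * k) (hk : 1 ≤ k)
    (u z : (Fin m → Fin n) → F) (i : Fin m) (hu : onAx (RS k ev) i u) (hz : onAx (RS k ev) i z) :
    lineWt (n := fun _ : Fin m => n) (u - z) i ≤ 3 * (hd u z : ℝ) / (Fintype.card (Fin m → Fin n) : ℝ) := by
  rw [lineWt_eq]
  apply div_le_div_of_nonneg_right _ (by positivity)
  set A := (Finset.univ.filter (fun y : Fin m → Fin n =>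
        (fun s => u (Function.update y i s) - z (Function.update y i s)) ≠ 0)) with hA
  have h1 := hd_lines i u z
  have h2 : A.card * k ≤ ∑ y : Fin m → Fin n,
      hd (fun s => u (Function.update y i s)) (fun s => z (Function.update y i s)) := by
    rw [← smul_eq_mul]
    refine le_trans (Finset.card_nsmul_le_sum A (fun y =>
      hd (fun s => u (Function.update y i s)) (fun s => z (Function.update y i s))) k ?_)
      (Finset.sum_le_sum_of_subset (Finset.subset_univ _))
    intro y hy
    have hw := rs_wt hev hn (rs_sub (hu y) (hz y)) (Finset.mem_filter.1 hy).2
    simp only [sub_ne_zero] at hw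
    have : k ≤ 2 * k := by omega
    exact this.trans hw.le
  rw [h1] at h2
  have h3 : n * hd u z = (3 * hd u z) * k := by
    have : n * hd u z = (3 * k) * hd u z := by rw [← hn]
    rw [this]; ring
  rw [h3] at h2
  exact_mod_cast Nat.le_of_mul_le_mul_right h2 hk

lemma part_three (hev : Function.Injective ev) (hn : n = 3 * k) (hk : 1 ≤ k) (hm : 2 ≤ m)
    (K : ℕ) (hK : AgreeK m K k ev) :
    1 / (3 * ((K : ℝ) + 1) * (m : ℝ) ^ 2) ≤
      agreeConst (n := fun _ : Fin m => n) (fun _ => RS k ev) := by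
  have hn0 : 0 < n := by omega
  haveI : Nonempty (Fin n) := ⟨⟨0, hn0⟩⟩
  have hN : (0 : ℝ) < (Fintype.card (Fin m → Fin n) : ℝ) := by exact_mod_cast Fintype.card_pos
  set N : ℝ := (Fintype.card (Fin m → Fin n) : ℝ) with hNdef
  have hm0 : (0 : ℝ) < m := by exact_mod_cast (by omega : 0 < m)
  have hlw0 : ∀ (u z : (Fin m → Fin n) → F) i, 0 ≤ lineWt (n := fun _ : Fin m => n) (u - z) i := by
    intro u z i; rw [lineWt_eq]; positivity
  have hlw1 : ∀ (u z : (Fin m → Fin n) → F) i, u ≠ z →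
      1 / N ≤ lineWt (n := fun _ : Fin m => n) (u - z) i := by
    intro u z i hne
    rw [lineWt_eq]
    apply div_le_div_of_nonneg_right _ hN.le
    rw [Nat.one_le_cast, Nat.one_le_iff_ne_zero, ← Nat.pos_iff_ne_zero, Finset.card_pos]
    obtain ⟨y, hy⟩ := Function.ne_iff.1 hne
    refine ⟨y, Finset.mem_filter.2 ⟨Finset.mem_univ _, ?_⟩⟩
    intro h
    have := congrFun h (y i)
    simp only [Function.update_eq_self] at this
    exact hy (sub_eq_zero.1 this)
  apply le_csSup
  · let i0 : Fin m := ⟨0, by omega⟩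
    let i1 : Fin m := ⟨1, by omega⟩
    let c : Fin m → (Fin m → Fin n) → F := fun i => if i = i0 then 1 else 0
    set R := (∑ i, ∑ j, normWt (c i - c j)) / ((m : ℝ) ^ 2) with hR
    have hR0 : 0 ≤ R := by
      apply div_nonneg _ (by positivity)
      apply Finset.sum_nonneg; intro i _
      apply Finset.sum_nonneg; intro j _
      rw [normWt_sub_eq]; positivity
    refine ⟨R * (N * m), ?_⟩
    intro α hα
    obtain ⟨z, _, hz⟩ := hα c (by
      intro i y
      by_cases hi : i = i0
      · simp only [c, hi, if_true]
        refine ⟨1, ?_, fun s => by simp [lineRestrict]⟩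
        rw [degree_one]; exact_mod_cast hk
      · simp only [c, hi, if_false]
        exact rs_zero)
    by_cases hα0 : α ≤ 0
    · exact hα0.trans (by positivity)
    push Not at hα0
    have hex : ∃ i, c i ≠ z := by
      by_contra hcon
      push Not at hcon
      have h1 := (hcon i0).trans (hcon i1).symm
      have h2 := congrFun h1 (fun _ => ⟨0, hn0⟩)
      simp [c, i0, i1] at h2
    obtain ⟨i, hi⟩ := hex
    have h1 : 1 / N ≤ ∑ i, lineWt (n := fun _ : Fin m => n) (c i - z) i :=
      (hlw1 (c i) z i hi).trans (Finset.single_le_sum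
        (f := fun i => lineWt (n := fun _ : Fin m => n) (c i - z) i) (fun i _ => hlw0 _ _ _)
        (Finset.mem_univ i))
    have h2 : α * (1 / N / m) ≤ R := by
      refine le_trans ?_ hz
      apply mul_le_mul_of_nonneg_left _ hα0.le
      exact div_le_div_of_nonneg_right h1 hm0.le
    calc α = α * (1 / N / m) * (N * m) := by field_simp
      _ ≤ _ := mul_le_mul_of_nonneg_right h2 (by positivity)
  · intro c hc
    obtain ⟨z, hz, hz'⟩ := hK c hc
    refine ⟨z, (mem_prod_iff z).2 hz, ?_⟩
    set S := ∑ i, ∑ j, hd (c i) (c j) with hS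
    have h1 : (∑ i, ∑ j, normWt (c i - c j)) = (S : ℝ) / N := by
      rw [hS]
      push_cast
      rw [Finset.sum_div]
      apply Finset.sum_congr rfl; intro i _
      rw [Finset.sum_div]
      apply Finset.sum_congr rfl; intro j _
      rw [normWt_sub_eq]
    have h2 : ∑ i, lineWt (n := fun _ : Fin m => n) (c i - z) i ≤ m * (3 * ((K + 1) * S) / N) := by
      calc _ ≤ ∑ i : Fin m, 3 * (((K : ℝ) + 1) * S) / N := by
            apply Finset.sum_le_sum
            intro i _
            refine (lineWt_le hev hn hk (c i) z i (hc i) (hz i)).trans ?_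
            apply div_le_div_of_nonneg_right _ hN.le
            have : (hd (c i) z : ℝ) ≤ K * S := by exact_mod_cast hz' i
            have hS0 : (0 : ℝ) ≤ S := by positivity
            linarith
        _ = _ := by simp
    have key : (∑ i, lineWt (n := fun _ : Fin m => n) (c i - z) i) / (m : ℝ) ≤
        3 * ((K + 1) * S) / N := by
      rw [div_le_iff₀ hm0, mul_comm]; exact h2
    have h1' : (∑ i, ∑ j, normWt (c i - c j)) / ((m : ℝ) ^ 2) = (S : ℝ) / N / (m : ℝ) ^ 2 := by rw [h1]
    refine le_trans (mul_le_mul_of_nonneg_left key (by positivity)) (le_trans (le_of_eq ?_) h1'.ge)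
    field_simp

end RSgrid

section RSgrid
open scoped Classical

lemma sum_update_gen {A : Type*} [AddCommMonoid A] {m n : ℕ} (i : Fin m) (φ : (Fin m → Fin n) → A) :
    ∑ y : Fin m → Fin n, ∑ s : Fin n, φ (Function.update y i s) = n • ∑ y, φ y := by
  have hinv : Function.Involutive (fun p : (Fin m → Fin n) × Fin n => (Function.update p.1 i p.2, p.1 i)) := by
    rintro ⟨y, s⟩
    simp
  rw [← Fintype.sum_prod_type' (fun y s => φ (Function.update y i s))]
  rw [← Equiv.sum_comp hinv.toPerm]
  simp only [Function.Involutive.coe_toPerm, Function.update_idem, Function.update_eq_self]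
  rw [Fintype.sum_prod_type]
  simp [Finset.smul_sum]

variable {F : Type} [Field F] {n k m : ℕ}

lemma axis_mem_box {C : Set (Fin n → F)} (hnF : (n : F) ≠ 0) (i : Fin m) (a : (Fin m → Fin n) → F)
    (ha : onAx C i a) (x : (Fin m → Fin n) → F)
    (hx : x ∈ prodCode (n := fun _ : Fin m => n) (fun _ => dualCode C)) :
    ∑ y, a y * x y = 0 := by
  have h1 := sum_update_gen i (fun y => a y * x y)
  have h2 : ∀ y : Fin m → Fin n,
      ∑ s : Fin n, a (Function.update y i s) * x (Function.update y i s) = 0 := by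
    intro y
    have h3 := (Set.mem_iInter.1 hx i) y _ (ha y)
    rw [← h3]
    apply Finset.sum_congr rfl
    intro s _
    exact mul_comm _ _
  simp only [h2, Finset.sum_const_zero, nsmul_eq_mul] at h1
  rcases mul_eq_zero.1 h1.symm with h | h
  · exact absurd h hnF
  · exact h

/-- support of the bad word -/
def suppP (n : ℕ) (i0 i1 i2 : Fin m) (y : Fin m → Fin n) : Prop :=
  n ∣ (y i0 : ℕ) + y i1 + y i2 ∧ ∀ l, l ≠ i0 → l ≠ i1 → l ≠ i2 → (y l : ℕ) = 0

lemma mod_cancel {A u u' : ℕ} (h : n ∣ A + u) (h' : n ∣ A + u') (hu : u < n) (hu' : u' < n) : u = u' := by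
  have h1 : A + u ≡ A + u' [MOD n] :=
    (Nat.modEq_zero_iff_dvd.2 h).trans (Nat.modEq_zero_iff_dvd.2 h').symm
  exact Nat.ModEq.eq_of_lt_of_lt (Nat.ModEq.add_left_cancel' A h1) hu hu'

lemma supp_line {i0 i1 i2 : Fin m} (h01 : i0 ≠ i1) (h02 : i0 ≠ i2) (h12 : i1 ≠ i2)
    {y y' : Fin m → Fin n} (hy : suppP n i0 i1 i2 y) (hy' : suppP n i0 i1 i2 y') (i : Fin m)
    (h : ∀ l, l ≠ i → y l = y' l) : y = y' := by
  have key : y i = y' i := by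
    apply Fin.ext
    by_cases e0 : i = i0
    · subst e0
      have e1 := h i1 (Ne.symm h01)
      have e2 := h i2 (Ne.symm h02)
      have a1 := hy.1
      have a2 := hy'.1
      rw [← e1, ← e2] at a2
      exact mod_cancel (A := (y i1 : ℕ) + y i2) (by convert a1 using 1; ring)
        (by convert a2 using 1; ring) (y i).2 (y' i).2
    by_cases e1 : i = i1
    · subst e1
      have e1 := h i0 h01
      have e2 := h i2 (Ne.symm h12)
      have a1 := hy.1
      have a2 := hy'.1
      rw [← e1, ← e2] at a2
      exact mod_cancel (A := (y i0 : ℕ) + y i2) (by convert a1 using 1; ring)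
        (by convert a2 using 1; ring) (y i).2 (y' i).2
    by_cases e2 : i = i2
    · subst e2
      have e1 := h i0 h02
      have e2 := h i1 h12
      have a1 := hy.1
      have a2 := hy'.1
      rw [← e1, ← e2] at a2
      exact mod_cancel (A := (y i0 : ℕ) + y i1) a1 a2 (y i).2 (y' i).2
    rw [hy.2 i e0 e1 e2, hy'.2 i e0 e1 e2]
  funext l
  by_cases hl : l = i
  · rw [hl, key]
  · exact h l hl

/-- character words -/
def chW (v : F) (k : ℕ) (i0 i1 i2 : Fin m) (j : ℕ) (y : Fin m → Fin n) : F :=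
  (if ∀ l, l ≠ i0 → l ≠ i1 → l ≠ i2 → (y l : ℕ) = 0 then 1 else 0) *
    (v ^ (j * (y i0 : ℕ)) * v ^ ((j + k) * (y i1 : ℕ)) * v ^ ((j + 2 * k) * (y i2 : ℕ)))

lemma char_rs {v : F} (hv : v ^ n = 1) (a : F) (e : ℕ) (he : e % n < k) :
    (fun s : Fin n => a * v ^ (e * (s : ℕ))) ∈ RS k (fun s : Fin n => v ^ (s : ℕ)) := by
  apply rs_smul
  refine ⟨X ^ (e % n), ?_, ?_⟩
  · rw [degree_X_pow]; exact_mod_cast he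
  · intro s
    rw [eval_pow, eval_X]
    show v ^ (e * (s : ℕ)) = (v ^ (s : ℕ)) ^ (e % n)
    conv_lhs => rw [← Nat.mod_add_div e n]
    rw [add_mul, pow_add, mul_assoc n, pow_mul v n, hv, one_pow, mul_one, mul_comm, pow_mul]

lemma chW_axis {v : F} (hv : v ^ n = 1) (hn : n = 3 * k) {i0 i1 i2 : Fin m} (h01 : i0 ≠ i1)
    (h02 : i0 ≠ i2) (h12 : i1 ≠ i2) (j : ℕ) (hj : j < n) :
    ∃ i, onAx (RS k (fun s : Fin n => v ^ (s : ℕ))) i (chW (n := n) v k i0 i1 i2 j) := by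
  have hD : ∀ (i : Fin m), (i = i0 ∨ i = i1 ∨ i = i2) → ∀ (y : Fin m → Fin n) s,
      ((∀ l, l ≠ i0 → l ≠ i1 → l ≠ i2 → (Function.update y i s l : ℕ) = 0) ↔
        (∀ l, l ≠ i0 → l ≠ i1 → l ≠ i2 → (y l : ℕ) = 0)) := by
    intro i hi y s
    refine forall_congr' fun l => ?_
    refine forall_congr' fun a0 => forall_congr' fun a1 => forall_congr' fun a2 => ?_
    have : l ≠ i := by rintro rfl; tauto
    rw [Function.update_of_ne this]
  by_cases c0 : j < k
  · refine ⟨i0, fun y => ?_⟩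
    have := char_rs (k := k) hv ((if ∀ l, l ≠ i0 → l ≠ i1 → l ≠ i2 → (y l : ℕ) = 0 then 1 else 0) *
      (v ^ ((j + k) * (y i1 : ℕ)) * v ^ ((j + 2 * k) * (y i2 : ℕ)))) j
      (by rw [Nat.mod_eq_of_lt hj]; exact c0)
    convert this using 2 with s
    unfold chW
    rw [if_congr (hD i0 (by simp) y s) rfl rfl, Function.update_self,
      Function.update_of_ne (Ne.symm h01), Function.update_of_ne (Ne.symm h02)]
    ring
  by_cases c1 : j < 2 * k
  · refine ⟨i2, fun y => ?_⟩
    have := char_rs (k := k) hv ((if ∀ l, l ≠ i0 → l ≠ i1 → l ≠ i2 → (y l : ℕ) = 0 then 1 else 0) *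
      (v ^ (j * (y i0 : ℕ)) * v ^ ((j + k) * (y i1 : ℕ)))) (j + 2 * k)
      (by
        have : j + 2 * k = (j - k) + n := by omega
        rw [this, Nat.add_mod_right, Nat.mod_eq_of_lt (by omega : j - k < n)]; omega)
    convert this using 2 with s
    unfold chW
    rw [if_congr (hD i2 (by simp) y s) rfl rfl, Function.update_self,
      Function.update_of_ne h02, Function.update_of_ne h12]
    ring
  · refine ⟨i1, fun y => ?_⟩
    have := char_rs (k := k) hv ((if ∀ l, l ≠ i0 → l ≠ i1 → l ≠ i2 → (y l : ℕ) = 0 then 1 else 0) *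
      (v ^ (j * (y i0 : ℕ)) * v ^ ((j + 2 * k) * (y i2 : ℕ)))) (j + k)
      (by
        have : j + k = (j - 2 * k) + n := by omega
        rw [this, Nat.add_mod_right, Nat.mod_eq_of_lt (by omega : j - 2 * k < n)]; omega)
    convert this using 2 with s
    unfold chW
    rw [if_congr (hD i1 (by simp) y s) rfl rfl, Function.update_self,
      Function.update_of_ne h01, Function.update_of_ne (Ne.symm h12)]
    ring

lemma chW_sum {v : F} (hv : IsPrimitiveRoot v n) (i0 i1 i2 : Fin m) (y : Fin m → Fin n) :
    ∑ j ∈ Finset.range n, chW v k i0 i1 i2 j y =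
      if suppP n i0 i1 i2 y then (n : F) * (v ^ (k * (y i1 : ℕ)) * v ^ (2 * k * (y i2 : ℕ))) else 0 := by
  have h1 : ∀ j, chW v k i0 i1 i2 j y =
      (if ∀ l, l ≠ i0 → l ≠ i1 → l ≠ i2 → (y l : ℕ) = 0 then 1 else 0) *
      (v ^ (k * (y i1 : ℕ)) * v ^ (2 * k * (y i2 : ℕ))) *
        (v ^ ((y i0 : ℕ) + y i1 + y i2)) ^ j := by
    intro j
    unfold chW
    rw [mul_assoc (ite _ _ _) _ ((v ^ ((y i0 : ℕ) + y i1 + y i2)) ^ j), ← pow_add, ← pow_add,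
      ← pow_add, ← pow_mul, ← pow_add]
    congr 2
    ring
  simp only [h1]
  rw [← Finset.mul_sum]
  have h2 : ∑ j ∈ Finset.range n, (v ^ ((y i0 : ℕ) + y i1 + y i2)) ^ j =
      if n ∣ (y i0 : ℕ) + y i1 + y i2 then (n : F) else 0 := by
    split_ifs with hd
    · rw [(hv.pow_eq_one_iff_dvd _).2 hd]; simp
    · have hr : v ^ ((y i0 : ℕ) + y i1 + y i2) ≠ 1 := fun h => hd ((hv.pow_eq_one_iff_dvd _).1 h)
      rw [geom_sum_eq hr, ← pow_mul, mul_comm, pow_mul, hv.pow_eq_one]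
      simp
  rw [h2]
  unfold suppP
  by_cases a : n ∣ (y i0 : ℕ) + y i1 + y i2
  · by_cases b : ∀ l, l ≠ i0 → l ≠ i1 → l ≠ i2 → (y l : ℕ) = 0
    · rw [if_pos b, if_pos a, if_pos ⟨a, b⟩]; ring
    · rw [if_neg b, if_neg (fun h : _ ∧ _ => b h.2)]; ring
  · rw [if_neg a, if_neg (fun h : _ ∧ _ => a h.1)]; ring

lemma part_one {v : F} (hv : IsPrimitiveRoot v n) (hn : n = 3 * k) (hk : 1 ≤ k) (hm : 3 ≤ m)
    (hnF : (n : F) ≠ 0) :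
    prodExpConst (n := fun _ : Fin m => n) (fun _ => RS k (fun s : Fin n => v ^ (s : ℕ))) ≤
      1 / (n : ℝ) := by
  have hn0 : 0 < n := by omega
  have hnR : (0 : ℝ) < n := by exact_mod_cast hn0
  have : Nonempty (Fin n) := ⟨⟨0, hn0⟩⟩
  have hN : (0 : ℝ) < (Fintype.card (Fin m → Fin n) : ℝ) := by exact_mod_cast Fintype.card_pos
  have hv0 : v ≠ 0 := hv.ne_zero (by omega)
  apply Real.sSup_le _ (by positivity)
  intro ρ hρ
  by_cases hρ0 : ρ ≤ 0
  · exact hρ0.trans (by positivity)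
  push Not at hρ0
  obtain ⟨i0, hi0⟩ : ∃ i : Fin m, (i : ℕ) = 0 := ⟨⟨0, by omega⟩, rfl⟩
  obtain ⟨i1, hi1⟩ : ∃ i : Fin m, (i : ℕ) = 1 := ⟨⟨1, by omega⟩, rfl⟩
  obtain ⟨i2, hi2⟩ : ∃ i : Fin m, (i : ℕ) = 2 := ⟨⟨2, by omega⟩, rfl⟩
  have h01 : i0 ≠ i1 := by intro h; rw [h] at hi0; omega
  have h02 : i0 ≠ i2 := by intro h; rw [h] at hi0; omega
  have h12 : i1 ≠ i2 := by intro h; rw [h] at hi1; omega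
  let c : (Fin m → Fin n) → F := fun y => ∑ j ∈ Finset.range n, chW v k i0 i1 i2 j y
  have hc : ∀ y, c y ≠ 0 → suppP n i0 i1 i2 y := by
    intro y hy
    by_contra hcon
    apply hy
    simp only [c]
    rw [chW_sum hv, if_neg hcon]
  have hbox : c ∈ boxCode (n := fun _ : Fin m => n) (fun _ => RS k (fun s : Fin n => v ^ (s : ℕ))) := by
    intro x hx
    have : ∀ y, c y * x y = ∑ j ∈ Finset.range n, chW v k i0 i1 i2 j y * x y := by
      intro y; simp only [c, Finset.sum_mul]
    have h2 : ∑ y, c y * x y = 0 := by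
      simp only [this]
      rw [Finset.sum_comm]
      apply Finset.sum_eq_zero
      intro j hj
      obtain ⟨i, hi⟩ := chW_axis hv.pow_eq_one hn h01 h02 h12 j (Finset.mem_range.1 hj)
      exact axis_mem_box hnF i _ hi x hx
    exact h2
  obtain ⟨a, ha, hsum, hle⟩ := hρ c hbox
  let M : Finset (Fin m → Fin n) := Finset.univ.filter (fun y => c y ≠ 0)
  let A : Fin m → Finset (Fin m → Fin n) := fun i => M.filter (fun y => a i y ≠ 0)
  let L : Fin m → Finset (Fin m → Fin n) := fun i => Finset.univ.filter (fun y : Fin m → Fin n =>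
        (fun s => a i (Function.update y i s) - (0 : (Fin m → Fin n) → F) (Function.update y i s)) ≠ 0)
  have hM0 : 0 < M.card := by
    apply Finset.card_pos.2
    refine ⟨fun _ => ⟨0, hn0⟩, Finset.mem_filter.2 ⟨Finset.mem_univ _, ?_⟩⟩
    simp only [c]
    rw [chW_sum hv, if_pos (by unfold suppP; simp)]
    simp [hnF]
  have hMA : M.card ≤ ∑ i, (A i).card := by
    refine le_trans (Finset.card_le_card ?_) Finset.card_biUnion_le
    intro y hy
    by_contra hcon
    have h0 := (Finset.mem_filter.1 hy).2
    apply h0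
    rw [hsum, Finset.sum_apply]
    apply Finset.sum_eq_zero
    intro i _
    by_contra hne
    exact hcon (Finset.mem_biUnion.2 ⟨i, Finset.mem_univ _, Finset.mem_filter.2 ⟨hy, hne⟩⟩)
  have hAL : ∀ i, (A i).card * n ≤ (L i).card := by
    intro i
    have h1 : (A i ×ˢ (Finset.univ : Finset (Fin n))).card = (A i).card * n := by
      rw [Finset.card_product, Finset.card_fin]
    rw [← h1]
    apply Finset.card_le_card_of_injOn (fun p => Function.update p.1 i p.2)
    · rintro ⟨y, s⟩ hy
      have hy := (Finset.mem_product.1 hy).1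
      have hy2 := (Finset.mem_filter.1 hy).2
      refine Finset.mem_coe.2 (Finset.mem_filter.2 ⟨Finset.mem_univ _, ?_⟩)
      intro h
      have := congrFun h (y i)
      simp only [Function.update_idem, Function.update_eq_self] at this
      apply hy2
      simpa using this
    · rintro ⟨y, s⟩ hy ⟨y', s'⟩ hy' h
      have hy := hc y (Finset.mem_filter.1 (Finset.mem_filter.1 (Finset.mem_product.1 hy).1).1).2
      have hy' := hc y' (Finset.mem_filter.1 (Finset.mem_filter.1 (Finset.mem_product.1 hy').1).1).2
      simp only at h
      have e1 : y = y' := supp_line h01 h02 h12 hy hy' i (by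
        intro l hl
        have := congrFun h l
        rwa [Function.update_of_ne hl, Function.update_of_ne hl] at this)
      have e2 : s = s' := by
        have := congrFun h i
        rwa [Function.update_self, Function.update_self] at this
      rw [e1, e2]
  have hfin : M.card * n ≤ ∑ i, (L i).card := by
    calc M.card * n ≤ (∑ i, (A i).card) * n := Nat.mul_le_mul_right _ hMA
      _ = ∑ i, (A i).card * n := Finset.sum_mul _ _ _
      _ ≤ _ := Finset.sum_le_sum (fun i _ => hAL i)
  have e1 : ∑ i, lineWt (n := fun _ : Fin m => n) (a i) i =
      ((∑ i, (L i).card : ℕ) : ℝ) / (Fintype.card (Fin m → Fin n) : ℝ) := by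
    push_cast
    rw [Finset.sum_div]
    apply Finset.sum_congr rfl
    intro i _
    have := lineWt_eq (a i) 0 i
    rw [sub_zero] at this
    exact this
  have e2 : normWt c = (M.card : ℝ) / (Fintype.card (Fin m → Fin n) : ℝ) := by
    have := normWt_sub_eq c 0
    rw [sub_zero] at this
    exact this
  have hle' : ρ * (((∑ i, (L i).card : ℕ) : ℝ) / (Fintype.card (Fin m → Fin n) : ℝ)) ≤
      (M.card : ℝ) / (Fintype.card (Fin m → Fin n) : ℝ) := by
    rw [← e1, ← e2]; exact hle
  rw [← mul_div_assoc, div_le_div_iff_of_pos_right hN] at hle'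
  have h5 : (M.card : ℝ) * n ≤ ((∑ i, (L i).card : ℕ) : ℝ) := by exact_mod_cast hfin
  have h6 : ρ * ((M.card : ℝ) * n) ≤ M.card := (mul_le_mul_of_nonneg_left h5 hρ0.le).trans hle'
  have hMR : (0 : ℝ) < M.card := by exact_mod_cast hM0
  rw [le_div_iff₀ hnR]
  by_contra hcon
  push Not at hcon
  nlinarith

end RSgrid

/-- for the primitive Reed–Solomon `[n_t, n_t/3]` codes over `F_{2^{2t}}`,
product expansion tends to zero while robust and agreement testability stay bounded
below by constants. -/
theorem stmt_19 (m : ℕ) (hm : 3 ≤ m) :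
    ∃ αr αa : ℝ, 0 < αr ∧ 0 < αa ∧
      ∀ t : ℕ, 1 ≤ t → ∀ (F : Type) [Field F] [Fintype F],
        Fintype.card F = 2 ^ (2 * t) →
        ∀ ω : Fˣ, (∀ u : Fˣ, u ∈ Subgroup.zpowers ω) →
          prodExpConst (n := fun _ : Fin m => 2 ^ (2 * t) - 1)
              (fun _ => cyclicCode (2 ^ (2 * t) - 1)
                (rsCheck ((2 ^ (2 * t) - 1) / 3) (ω : F))) ≤
            1 / ((2 ^ (2 * t) - 1 : ℕ) : ℝ) ∧
          αr ≤ lineRobustConst (n := fun _ : Fin m => 2 ^ (2 * t) - 1)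
              (fun _ => cyclicCode (2 ^ (2 * t) - 1)
                (rsCheck ((2 ^ (2 * t) - 1) / 3) (ω : F))) ∧
          αa ≤ agreeConst (n := fun _ : Fin m => 2 ^ (2 * t) - 1)
              (fun _ => cyclicCode (2 ^ (2 * t) - 1)
                (rsCheck ((2 ^ (2 * t) - 1) / 3) (ω : F))) := by
  obtain ⟨K, hK⟩ := rs_agree m (by omega)
  have hm0 : (0 : ℝ) < m := by exact_mod_cast (by omega : 0 < m)
  refine ⟨1 / ((m : ℝ) * (1 + 2 * m * K)), 1 / (3 * ((K : ℝ) + 1) * (m : ℝ) ^ 2), by positivity,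
    by positivity, ?_⟩
  intro t ht F _ _ hF ω hω
  obtain ⟨hw, hnF, hn, hk⟩ := field_facts t ht hF ω hω
  have hC := cyclic_eq_RS hw (Nat.div_le_self _ 3) hk hnF
  have hw' := hw.inv
  have hev : Function.Injective (fun s : Fin (2 ^ (2 * t) - 1) => ((ω : F)⁻¹) ^ (s : ℕ)) :=
    fun a b hab => Fin.ext (hw'.pow_inj a.2 b.2 hab)
  have hag : AgreeK m K ((2 ^ (2 * t) - 1) / 3)
      (fun s : Fin (2 ^ (2 * t) - 1) => ((ω : F)⁻¹) ^ (s : ℕ)) :=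
    hK F _ _ _ hev hn hk
  rw [hC]
  exact ⟨part_one hw' hn hk hm hnF, part_two hev hn hk (by omega) K hag,
    part_three hev hn hk (by omega) K hag⟩

end
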